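/- Let n ≥ 1, β > 0, and E : [n] → ℝ with E_i > 0 for all i; set Z := Σ_j e^{−βE_j} and let g be the Gibbs probability vector g_i := e^{−βE_i}/Z (which has full support). Let p and q be probability vectors on n points with p ≠ g. Then the following are equivalent: (1) p asymptotically catalytically thermally majorizes q, i.e., for every ε > 0 there exist a probability vector q_ε on n points with ‖q − q_ε‖₁ ≤ ε, probability vectors r^(1), r^(2) of some common finite length with supp r^(1) ⊆ supp r^(2), and a stochastic matrix T with T(p ⊗ r^(1)) = q_ε ⊗ r^(1) and T(g ⊗ r^(2)) = g ⊗ r^(2); (2) for every real α ≥ 1/2, D_α(p‖g) ≥ D_α(q‖g) and D_α(g‖p) ≥ D_α(g‖q) (inequalities in [0,∞]). (This is the classical form, for states diagonal in the energy eigenbasis, of the paper's corollary that ρ asymptotically catalytically thermally majorizes σ if and only if the free energies F^±_{α,β} satisfy F^±_{α,β}(ρ) ≥ F^±_{α,β}(σ) for all α ≥ 1/2.) -/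

import Mathlib

open Classical

noncomputable section

/-- `p` is a probability vector. -/
def IsProb {I : Type} [Fintype I] (p : I → ℝ) : Prop :=
  (∀ x, 0 ≤ p x) ∧ ∑ x, p x = 1

/-- `T` is a (column-)stochastic matrix (`T y x` is the entry in row `y`, column `x`). -/
def IsStoch {I J : Type} [Fintype I] [Fintype J] (T : J → I → ℝ) : Prop :=
  (∀ y x, 0 ≤ T y x) ∧ ∀ x, ∑ y, T y x = 1

/-- Kronecker product of two vectors. -/
def kron {I J : Type} (p : I → ℝ) (q : J → ℝ) : I × J → ℝ := fun x => p x.1 * q x.2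

/-- `n`-fold Kronecker power `p^{⊗n}`. -/
def kpow {I : Type} (p : I → ℝ) (n : ℕ) : (Fin n → I) → ℝ := fun f => ∏ j, p (f j)

/-- Index type of the catalyst `⊕_{ℓ=0}^{n} (q)^{⊗ℓ} ⊗ (p)^{⊗(n-ℓ)}`
(`I` indexes `p`, `J` indexes `q`). -/
abbrev CatIdx (I J : Type) (n : ℕ) : Type :=
  (ℓ : Fin (n + 1)) × ((Fin (ℓ : ℕ) → J) × (Fin (n - (ℓ : ℕ)) → I))

/-- The catalyst `r = (1/(n+1)) ⊕_{ℓ=0}^{n} q^{⊗ℓ} ⊗ p^{⊗(n-ℓ)}`. -/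
def catVec {I J : Type} (n : ℕ) (p : I → ℝ) (q : J → ℝ) : CatIdx I J n → ℝ :=
  fun x => (1 / (n + 1 : ℝ)) * ((∏ j, q (x.2.1 j)) * ∏ j, p (x.2.2 j))

/-- The multivariate monotone `Φ_{α,C}` (convention `0^0 = 1` of `rpow`). -/
def phiAC {I : Type} [Fintype I] (d : ℕ) (α : Fin d → ℝ) (C : Finset (Fin d))
    (p : Fin d → I → ℝ) : ℝ :=
  ∑ x ∈ Finset.univ.filter (fun x => ∀ c ∈ C, p c x ≠ 0), ∏ k, p k x ^ α k

/-- The standard basis vector `e_k` of `ℝ^d`. -/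
def stdBasis (d : ℕ) (k : Fin d) : Fin d → ℝ := fun j => if j = k then 1 else 0

/-- ℓ¹-distance of vectors. -/
def dist1 {I : Type} [Fintype I] (p q : I → ℝ) : ℝ := ∑ x, |p x - q x|

/-- A dichotomy: a pair of probability vectors with `supp p ⊆ supp q`. -/
def IsDichotomy {I : Type} [Fintype I] (p q : I → ℝ) : Prop :=
  IsProb p ∧ IsProb q ∧ ∀ x, p x ≠ 0 → q x ≠ 0

/-- The Rényi divergence `D_α(p‖q)` for `α ∈ [0,∞)`, with values in `EReal`
(`⊤` encodes `+∞`; all divergences are `⊤` if `supp p ∩ supp q = ∅`). -/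
def renyi {I : Type} [Fintype I] (α : ℝ) (p q : I → ℝ) : EReal :=
  if ¬ ∃ x, p x ≠ 0 ∧ q x ≠ 0 then ⊤
  else if α = 0 then
    ((-Real.log (∑ x ∈ Finset.univ.filter (fun x => p x ≠ 0 ∧ q x ≠ 0), q x) : ℝ) : EReal)
  else if α < 1 then
    (((α - 1)⁻¹ * Real.log (∑ x ∈ Finset.univ.filter (fun x => p x ≠ 0 ∧ q x ≠ 0),
        p x ^ α * q x ^ (1 - α)) : ℝ) : EReal)
  else if α = 1 then
    if ∀ x, p x ≠ 0 → q x ≠ 0 then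
      ((∑ x ∈ Finset.univ.filter (fun x => p x ≠ 0), p x * Real.log (p x / q x) : ℝ) : EReal)
    else ⊤
  else
    if ∀ x, p x ≠ 0 → q x ≠ 0 then
      (((α - 1)⁻¹ * Real.log (∑ x ∈ Finset.univ.filter (fun x => p x ≠ 0),
          p x ^ α * q x ^ (1 - α)) : ℝ) : EReal)
    else ⊤

/-- The max divergence `D_∞(p‖q)`, with values in `EReal`. -/
def renyiTop {I : Type} [Fintype I] (p q : I → ℝ) : EReal :=
  if h : ∃ x, p x ≠ 0 ∧ q x ≠ 0 then
    if ∀ x, p x ≠ 0 → q x ≠ 0 then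
      ((Real.log ((Finset.univ.filter fun x => p x ≠ 0).sup'
        ⟨h.choose, Finset.mem_filter.mpr ⟨Finset.mem_univ _, h.choose_spec.1⟩⟩
        fun x => p x / q x) : ℝ) : EReal)
    else ⊤
  else ⊤

section DataProcessing

variable {I J : Type} [Fintype I] [Fintype J]

/-- The power sum `∑ₓ p(x)^α g(x)^{1-α}` inside the Rényi divergence. -/
def powerSum (α : ℝ) (p g : I → ℝ) : ℝ := ∑ x, p x ^ α * g x ^ (1 - α)

theorem powerSum_swap (α : ℝ) (p g : I → ℝ) : powerSum (1 - α) p g = powerSum α g p := by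
  simp only [powerSum, sub_sub_cancel, mul_comm]

theorem powerSum_pos (α : ℝ) {p g : I → ℝ} (hp : ∀ x, 0 ≤ p x) (hg : ∀ x, 0 ≤ g x)
    (h : ∃ x, p x ≠ 0 ∧ g x ≠ 0) : 0 < powerSum α p g := by
  obtain ⟨x, h1, h2⟩ := h
  refine Finset.sum_pos' (fun x _ => mul_nonneg (Real.rpow_nonneg (hp x) _)
    (Real.rpow_nonneg (hg x) _)) ⟨x, Finset.mem_univ _, ?_⟩
  exact mul_pos (Real.rpow_pos_of_pos ((hp x).lt_of_ne' h1) _)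
    (Real.rpow_pos_of_pos ((hg x).lt_of_ne' h2) _)

theorem powerSum_kron (α : ℝ) {p g : I → ℝ} {r s : J → ℝ} (hp : ∀ x, 0 ≤ p x)
    (hg : ∀ x, 0 ≤ g x) (hr : ∀ x, 0 ≤ r x) (hs : ∀ x, 0 ≤ s x) :
    powerSum α (kron p r) (kron g s) = powerSum α p g * powerSum α r s := by
  simp only [powerSum, kron, Fintype.sum_prod_type, Finset.sum_mul_sum]
  refine Finset.sum_congr rfl fun x _ => Finset.sum_congr rfl fun y _ => ?_
  rw [Real.mul_rpow (hp x) (hr y), Real.mul_rpow (hg x) (hs y)]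
  ring

theorem powerSum_le_of_stoch {α : ℝ} (h0 : 0 < α) (h1 : α < 1) {T : J → I → ℝ} (hT : IsStoch T)
    {p g : I → ℝ} {q h : J → ℝ} (hp : ∀ x, 0 ≤ p x) (hg : ∀ x, 0 ≤ g x)
    (hq : ∀ y, ∑ x, T y x * p x = q y) (hh : ∀ y, ∑ x, T y x * g x = h y) :
    powerSum α p g ≤ powerSum α q h := by
  have key : ∀ y, ∑ x, T y x * (p x ^ α * g x ^ (1 - α)) ≤ q y ^ α * h y ^ (1 - α) := by
    intro y
    have hc : (1 / α).HolderConjugate (1 / (1 - α)) := by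
      rw [Real.holderConjugate_iff]
      constructor
      · rw [lt_div_iff₀ h0]; linarith
      · simp
    have := Real.inner_le_Lp_mul_Lq_of_nonneg (Finset.univ : Finset I) hc
      (f := fun x => (T y x * p x) ^ α) (g := fun x => (T y x * g x) ^ (1 - α))
      (fun x _ => Real.rpow_nonneg (mul_nonneg (hT.1 y x) (hp x)) _)
      (fun x _ => Real.rpow_nonneg (mul_nonneg (hT.1 y x) (hg x)) _)
    have e1 : ∀ x, ((T y x * p x) ^ α) ^ (1 / α) = T y x * p x := fun x => by
      rw [← Real.rpow_mul (mul_nonneg (hT.1 y x) (hp x)), mul_one_div_cancel h0.ne', Real.rpow_one]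
    have e2 : ∀ x, ((T y x * g x) ^ (1 - α)) ^ (1 / (1 - α)) = T y x * g x := fun x => by
      rw [← Real.rpow_mul (mul_nonneg (hT.1 y x) (hg x)), mul_one_div_cancel (by linarith),
        Real.rpow_one]
    simp only [e1, e2, hq, hh, one_div_one_div] at this
    refine le_trans (le_of_eq (Finset.sum_congr rfl fun x _ => ?_)) this
    rw [Real.mul_rpow (hT.1 y x) (hp x), Real.mul_rpow (hT.1 y x) (hg x)]
    rcases (hT.1 y x).eq_or_lt with hz | hz
    · rw [← hz, Real.zero_rpow h0.ne']; ring
    · have : T y x ^ α * T y x ^ (1 - α) = T y x := by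
        rw [← Real.rpow_add hz]; simp
      linear_combination (-(p x ^ α * g x ^ (1 - α))) * this
  calc powerSum α p g = ∑ x, (∑ y, T y x) * (p x ^ α * g x ^ (1 - α)) := by
        simp [powerSum, hT.2]
    _ = ∑ y, ∑ x, T y x * (p x ^ α * g x ^ (1 - α)) := by
        simp only [Finset.sum_mul]; exact Finset.sum_comm
    _ ≤ _ := Finset.sum_le_sum fun y _ => key y

theorem stoch_powerSum_le {α : ℝ} (h1 : 1 < α) {T : J → I → ℝ} (hT : IsStoch T)
    {p g : I → ℝ} {q h : J → ℝ} (hp : ∀ x, 0 ≤ p x) (hg : ∀ x, 0 ≤ g x)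
    (hs : ∀ x, p x ≠ 0 → g x ≠ 0)
    (hq : ∀ y, ∑ x, T y x * p x = q y) (hh : ∀ y, ∑ x, T y x * g x = h y) :
    powerSum α q h ≤ powerSum α p g := by
  have h0 : 0 < α := by linarith
  have key : ∀ y, q y ^ α * h y ^ (1 - α) ≤ ∑ x, T y x * (p x ^ α * g x ^ (1 - α)) := by
    intro y
    have hy : 0 ≤ h y := by
      rw [← hh]; exact Finset.sum_nonneg fun x _ => mul_nonneg (hT.1 y x) (hg x)
    have hqy : 0 ≤ q y := by
      rw [← hq]; exact Finset.sum_nonneg fun x _ => mul_nonneg (hT.1 y x) (hp x)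
    have hR : 0 ≤ ∑ x, T y x * (p x ^ α * g x ^ (1 - α)) :=
      Finset.sum_nonneg fun x _ => mul_nonneg (hT.1 y x)
        (mul_nonneg (Real.rpow_nonneg (hp x) _) (Real.rpow_nonneg (hg x) _))
    have := Real.inner_le_weight_mul_Lp_of_nonneg (Finset.univ : Finset I) h1.le
      (fun x => T y x * g x) (fun x => p x / g x) (fun x => mul_nonneg (hT.1 y x) (hg x))
      (fun x => div_nonneg (hp x) (hg x))
    have e1 : ∀ x, T y x * g x * (p x / g x) = T y x * p x := fun x => by
      by_cases hgx : g x = 0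
      · have : p x = 0 := by by_contra hc; exact hs x hc hgx
        simp [this]
      · field_simp
    have e2 : ∀ x, T y x * g x * (p x / g x) ^ α = T y x * (p x ^ α * g x ^ (1 - α)) := fun x => by
      rcases (hg x).eq_or_lt with hgx | hgx
      · have : p x = 0 := by by_contra hc; exact hs x hc hgx.symm
        simp [this, ← hgx, Real.zero_rpow h0.ne']
      · rw [Real.div_rpow (hp x) (hg x), Real.rpow_sub hgx, Real.rpow_one]; ring
    simp only [e1, e2, hq, hh] at this
    rcases hy.eq_or_lt with hy0 | hy0
    · rw [← hy0, Real.zero_rpow (by linarith), mul_zero]; exact hR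
    · have h2 : q y ^ α ≤ h y ^ (α - 1) * ∑ x, T y x * (p x ^ α * g x ^ (1 - α)) := by
        refine (Real.rpow_le_rpow hqy this h0.le).trans (le_of_eq ?_)
        rw [Real.mul_rpow (Real.rpow_nonneg hy _) (Real.rpow_nonneg hR _), ← Real.rpow_mul hy,
          ← Real.rpow_mul hR, inv_mul_cancel₀ h0.ne', Real.rpow_one, sub_mul,
          inv_mul_cancel₀ h0.ne', one_mul]
      calc q y ^ α * h y ^ (1 - α)
          ≤ (h y ^ (α - 1) * ∑ x, T y x * (p x ^ α * g x ^ (1 - α))) * h y ^ (1 - α) :=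
            mul_le_mul_of_nonneg_right h2 (Real.rpow_nonneg hy _)
        _ = (h y ^ (α - 1) * h y ^ (1 - α)) * ∑ x, T y x * (p x ^ α * g x ^ (1 - α)) := by ring
        _ = _ := by rw [← Real.rpow_add hy0]; simp
  calc powerSum α q h ≤ ∑ y, ∑ x, T y x * (p x ^ α * g x ^ (1 - α)) :=
        Finset.sum_le_sum fun y _ => key y
    _ = ∑ x, (∑ y, T y x) * (p x ^ α * g x ^ (1 - α)) := by
        simp only [Finset.sum_mul]; exact Finset.sum_comm
    _ = _ := by simp [powerSum, hT.2]

/-- A stochastic matrix that fixes `G` and maps the set `S` into itself fixes the restriction of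
`G` to `S`. -/
theorem stoch_fixes_restrict {T : I → I → ℝ} (hT : IsStoch T) {G : I → ℝ} (hG : ∀ x, 0 ≤ G x)
    (hfix : ∀ y, ∑ x, T y x * G x = G y) (S : I → Prop)
    (hS : ∀ x y, S x → ¬ S y → T y x = 0) (y : I) :
    ∑ x, T y x * (if S x then G x else 0) = if S y then G y else 0 := by
  by_cases hy : S y
  · rw [if_pos hy]
    have hsum : ∑ y, (if S y then ∑ x, T y x * (if S x then 0 else G x) else 0) = 0 := by
      have e : ∀ y, (if S y then ∑ x, T y x * (if S x then 0 else G x) else 0)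
          = (if S y then G y else 0) - ∑ x, T y x * (if S x then G x else 0) := by
        intro y
        by_cases hy : S y
        · simp only [if_pos hy]
          rw [← hfix y, ← Finset.sum_sub_distrib]
          refine Finset.sum_congr rfl fun x _ => ?_
          split_ifs <;> ring
        · simp only [if_neg hy]
          rw [Finset.sum_eq_zero, sub_zero]
          intro x _
          split_ifs with hx
          · rw [hS x y hx hy, zero_mul]
          · ring
      simp only [e, Finset.sum_sub_distrib]
      rw [Finset.sum_comm]
      simp [← Finset.sum_mul, hT.2]
    have h0 : ∀ x y, 0 ≤ T y x * (if S x then 0 else G x) := fun x y =>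
      mul_nonneg (hT.1 y x) (by split_ifs; exacts [le_rfl, hG x])
    have := (Finset.sum_eq_zero_iff_of_nonneg (fun y _ => by
      split_ifs
      · exact Finset.sum_nonneg fun x _ => h0 x y
      · exact le_rfl)).1 hsum y (Finset.mem_univ _)
    rw [if_pos hy] at this
    have e : ∑ x, T y x * (if S x then G x else 0) + ∑ x, T y x * (if S x then 0 else G x)
        = G y := by
      rw [← Finset.sum_add_distrib, ← hfix y]
      refine Finset.sum_congr rfl fun x _ => ?_
      split_ifs <;> ring
    linarith
  · rw [if_neg hy]
    refine Finset.sum_eq_zero fun x _ => ?_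
    split_ifs with hx
    · rw [hS x y hx hy, zero_mul]
    · ring

theorem klSum_le_of_powerSum_le {p g : I → ℝ} {q h : J → ℝ} (hp : ∀ x, 0 ≤ p x) (hg : ∀ x, 0 < g x)
    (hq : ∀ x, 0 ≤ q x) (hh : ∀ x, 0 < h x) (hpq : ∑ x, p x = ∑ x, q x)
    (H : ∀ α : ℝ, 1 < α → powerSum α q h ≤ powerSum α p g) :
    ∑ x, q x * Real.log (q x / h x) ≤ ∑ x, p x * Real.log (p x / g x) := by
  have key : ∀ a b : ℝ, 0 ≤ a → 0 < b →
      HasDerivAt (fun α : ℝ => a ^ α * b ^ (1 - α)) (a * Real.log (a / b)) 1 := by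
    intro a b ha hb
    rcases ha.eq_or_lt with ha | ha
    · subst ha
      simp only [zero_mul]
      refine (hasDerivAt_const (1 : ℝ) (0 : ℝ)).congr_of_eventuallyEq ?_
      filter_upwards [lt_mem_nhds (zero_lt_one' ℝ)] with α hα
      rw [Real.zero_rpow hα.ne', zero_mul]
    · have h1 := (hasDerivAt_id (1 : ℝ)).const_rpow ha
      have h2 := ((hasDerivAt_id (1 : ℝ)).const_sub 1).const_rpow hb
      refine (h1.mul h2).congr_deriv ?_
      simp only [id, sub_self, Real.rpow_one, Real.rpow_zero]
      rw [Real.log_div ha.ne' hb.ne']; ring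
  have hd : HasDerivAt (fun α : ℝ => powerSum α p g - powerSum α q h)
      (∑ x, p x * Real.log (p x / g x) - ∑ x, q x * Real.log (q x / h x)) 1 :=
    (HasDerivAt.fun_sum fun x _ => key _ _ (hp x) (hg x)).sub
      (HasDerivAt.fun_sum fun x _ => key _ _ (hq x) (hh x))
  rw [← sub_nonneg]
  have ht := hd.tendsto_slope.mono_left (nhdsWithin_mono (1 : ℝ)
    (show Set.Ioi (1 : ℝ) ⊆ {1}ᶜ from fun x hx => ne_of_gt hx))
  refine ge_of_tendsto ht ?_
  filter_upwards [self_mem_nhdsWithin] with α hα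
  have hα : (1 : ℝ) < α := hα
  have e : powerSum 1 p g - powerSum 1 q h = 0 := by simp [powerSum, hpq]
  rw [slope_def_field, e, sub_zero]
  exact div_nonneg (sub_nonneg.2 (H α hα)) (by linarith)

end DataProcessing

section Renyi

variable {I : Type} [Fintype I]

theorem renyi_of_lt_one {α : ℝ} (h0 : 0 < α) (h1 : α < 1) {p g : I → ℝ}
    (h : ∃ x, p x ≠ 0 ∧ g x ≠ 0) :
    renyi α p g = (((α - 1)⁻¹ * Real.log (powerSum α p g) : ℝ) : EReal) := by
  have e : ∑ x ∈ Finset.univ.filter (fun x => p x ≠ 0 ∧ g x ≠ 0), p x ^ α * g x ^ (1 - α)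
      = powerSum α p g := by
    refine Finset.sum_filter_of_ne fun x _ hx => ⟨fun hc => hx ?_, fun hc => hx ?_⟩
    · rw [hc, Real.zero_rpow h0.ne', zero_mul]
    · rw [hc, Real.zero_rpow (by linarith), mul_zero]
  rw [renyi, if_neg (not_not.2 h), if_neg h0.ne', if_pos h1, e]

theorem renyi_one_of_supp {p g : I → ℝ} (h : ∃ x, p x ≠ 0 ∧ g x ≠ 0)
    (hs : ∀ x, p x ≠ 0 → g x ≠ 0) :
    renyi 1 p g = ((∑ x, p x * Real.log (p x / g x) : ℝ) : EReal) := by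
  have e : ∑ x ∈ Finset.univ.filter (fun x => p x ≠ 0), p x * Real.log (p x / g x)
      = ∑ x, p x * Real.log (p x / g x) := by
    refine Finset.sum_filter_of_ne fun x _ hx hc => hx ?_
    rw [hc, zero_mul]
  rw [renyi, if_neg (not_not.2 h), if_neg one_ne_zero, if_neg (lt_irrefl _), if_pos rfl,
    if_pos hs, e]

theorem renyi_of_one_lt {α : ℝ} (h1 : 1 < α) {p g : I → ℝ} (h : ∃ x, p x ≠ 0 ∧ g x ≠ 0)
    (hs : ∀ x, p x ≠ 0 → g x ≠ 0) :
    renyi α p g = (((α - 1)⁻¹ * Real.log (powerSum α p g) : ℝ) : EReal) := by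
  have e : ∑ x ∈ Finset.univ.filter (fun x => p x ≠ 0), p x ^ α * g x ^ (1 - α)
      = powerSum α p g := by
    refine Finset.sum_filter_of_ne fun x _ hx hc => hx ?_
    rw [hc, Real.zero_rpow (by linarith), zero_mul]
  rw [renyi, if_neg (not_not.2 h), if_neg (by linarith), if_neg (not_lt.2 h1.le),
    if_neg h1.ne', if_pos hs, e]

theorem renyi_of_not_supp {α : ℝ} (h1 : 1 ≤ α) {p g : I → ℝ} (hs : ¬ ∀ x, p x ≠ 0 → g x ≠ 0) :
    renyi α p g = ⊤ := by
  rw [renyi]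
  split_ifs <;> first | rfl | linarith

/-- Comparison of all the moments of the relative densities of `p` and `q` with respect to `g`:
the content of the Rényi inequalities in both directions. -/
def MomentDominates (p q g : I → ℝ) : Prop :=
  (∀ α : ℝ, 0 < α → α < 1 → powerSum α p g ≤ powerSum α q g) ∧
  (∀ α : ℝ, 1 < α → powerSum α q g ≤ powerSum α p g) ∧
  (∑ x, q x * Real.log (q x / g x) ≤ ∑ x, p x * Real.log (p x / g x)) ∧
  ((∀ x, 0 < p x) → (∀ x, 0 < q x) ∧ (∀ α : ℝ, 1 < α → powerSum α g q ≤ powerSum α g p) ∧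
    ∑ x, g x * Real.log (g x / q x) ≤ ∑ x, g x * Real.log (g x / p x))

theorem IsProb.exists_ne_zero {p : I → ℝ} (hp : IsProb p) : ∃ x, p x ≠ 0 := by
  by_contra! h
  have := hp.2
  simp [h] at this

theorem renyi_le_iff_of_lt_one {α : ℝ} (h0 : 0 < α) (h1 : α < 1) {p q g h : I → ℝ}
    (hp : ∀ x, 0 ≤ p x) (hg : ∀ x, 0 ≤ g x) (hpg : ∃ x, p x ≠ 0 ∧ g x ≠ 0)
    (hq : ∀ x, 0 ≤ q x) (hh : ∀ x, 0 ≤ h x) (hqh : ∃ x, q x ≠ 0 ∧ h x ≠ 0) :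
    renyi α q h ≤ renyi α p g ↔ powerSum α p g ≤ powerSum α q h := by
  rw [renyi_of_lt_one h0 h1 hpg, renyi_of_lt_one h0 h1 hqh, EReal.coe_le_coe_iff,
    mul_le_mul_left_of_neg (inv_lt_zero.2 (by linarith)),
    Real.log_le_log_iff (powerSum_pos α hp hg hpg) (powerSum_pos α hq hh hqh)]

theorem renyi_le_iff_of_one_lt {α : ℝ} (h1 : 1 < α) {p q g h : I → ℝ}
    (hp : ∀ x, 0 ≤ p x) (hg : ∀ x, 0 ≤ g x) (hpg : ∃ x, p x ≠ 0 ∧ g x ≠ 0)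
    (hpg' : ∀ x, p x ≠ 0 → g x ≠ 0)
    (hq : ∀ x, 0 ≤ q x) (hh : ∀ x, 0 ≤ h x) (hqh : ∃ x, q x ≠ 0 ∧ h x ≠ 0)
    (hqh' : ∀ x, q x ≠ 0 → h x ≠ 0) :
    renyi α q h ≤ renyi α p g ↔ powerSum α q h ≤ powerSum α p g := by
  rw [renyi_of_one_lt h1 hpg hpg', renyi_of_one_lt h1 hqh hqh', EReal.coe_le_coe_iff,
    mul_le_mul_iff_right₀ (inv_pos.2 (by linarith)),
    Real.log_le_log_iff (powerSum_pos α hq hh hqh) (powerSum_pos α hp hg hpg)]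

theorem renyi_one_le_iff {p q g h : I → ℝ} (hpg : ∃ x, p x ≠ 0 ∧ g x ≠ 0)
    (hpg' : ∀ x, p x ≠ 0 → g x ≠ 0) (hqh : ∃ x, q x ≠ 0 ∧ h x ≠ 0)
    (hqh' : ∀ x, q x ≠ 0 → h x ≠ 0) :
    renyi 1 q h ≤ renyi 1 p g ↔
      ∑ x, q x * Real.log (q x / h x) ≤ ∑ x, p x * Real.log (p x / g x) := by
  rw [renyi_one_of_supp hpg hpg', renyi_one_of_supp hqh hqh', EReal.coe_le_coe_iff]

theorem renyi_forall_le_iff_momentDominates {p q g : I → ℝ} (hp : IsProb p) (hq : IsProb q)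
    (hg : ∀ x, 0 < g x) :
    (∀ α : ℝ, 1 / 2 ≤ α → renyi α q g ≤ renyi α p g ∧ renyi α g q ≤ renyi α g p) ↔
      MomentDominates p q g := by
  have hg' : ∀ x, g x ≠ 0 := fun x => (hg x).ne'
  have hg0 : ∀ x, 0 ≤ g x := fun x => (hg x).le
  obtain ⟨xp, hxp⟩ := hp.exists_ne_zero
  obtain ⟨xq, hxq⟩ := hq.exists_ne_zero
  have hpg : ∃ x, p x ≠ 0 ∧ g x ≠ 0 := ⟨xp, hxp, hg' _⟩
  have hqg : ∃ x, q x ≠ 0 ∧ g x ≠ 0 := ⟨xq, hxq, hg' _⟩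
  have hgp : ∃ x, g x ≠ 0 ∧ p x ≠ 0 := ⟨xp, hg' _, hxp⟩
  have hgq : ∃ x, g x ≠ 0 ∧ q x ≠ 0 := ⟨xq, hg' _, hxq⟩
  constructor
  · intro H
    refine ⟨fun α h0 h1 => ?_, fun α h1 => ?_, ?_, fun hpos => ?_⟩
    · rcases le_or_gt (1 / 2) α with h | h
      · exact (renyi_le_iff_of_lt_one h0 h1 hp.1 hg0 hpg hq.1 hg0 hqg).1 (H α h).1
      · have := (renyi_le_iff_of_lt_one (by linarith) (by linarith) hg0 hp.1 hgp hg0 hq.1 hgq).1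
          (H (1 - α) (by linarith)).2
        rwa [powerSum_swap, powerSum_swap] at this
    · exact (renyi_le_iff_of_one_lt h1 hp.1 hg0 hpg (fun x _ => hg' x) hq.1 hg0 hqg
        (fun x _ => hg' x)).1 (H α (by linarith)).1
    · exact (renyi_one_le_iff hpg (fun x _ => hg' x) hqg (fun x _ => hg' x)).1
        (H 1 (by norm_num)).1
    · have hsp : ∀ x, g x ≠ 0 → p x ≠ 0 := fun x _ => (hpos x).ne'
      have hsq : ∀ x, g x ≠ 0 → q x ≠ 0 := by
        by_contra hc
        have := (H 1 (by norm_num)).2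
        rw [renyi_of_not_supp le_rfl hc, renyi_one_of_supp hgp hsp, top_le_iff] at this
        exact EReal.coe_ne_top _ this
      refine ⟨fun x => (hq.1 x).lt_of_ne' (hsq x (hg' x)), fun α h1 => ?_, ?_⟩
      · exact (renyi_le_iff_of_one_lt h1 hg0 hp.1 hgp hsp hg0 hq.1 hgq hsq).1
          (H α (by linarith)).2
      · exact (renyi_one_le_iff hgp hsp hgq hsq).1 (H 1 (by norm_num)).2
  · rintro ⟨H1, H2, H3, H4⟩ α hα
    rcases lt_trichotomy α 1 with h1 | h1 | h1
    · have h0 : 0 < α := by linarith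
      rw [renyi_le_iff_of_lt_one h0 h1 hp.1 hg0 hpg hq.1 hg0 hqg,
        renyi_le_iff_of_lt_one h0 h1 hg0 hp.1 hgp hg0 hq.1 hgq, ← powerSum_swap α p g, ← powerSum_swap α q g]
      exact ⟨H1 _ h0 h1, H1 _ (by linarith) (by linarith)⟩
    · subst h1
      refine ⟨(renyi_one_le_iff hpg (fun x _ => hg' x) hqg (fun x _ => hg' x)).2 H3, ?_⟩
      by_cases hpos : ∀ x, g x ≠ 0 → p x ≠ 0
      · obtain ⟨h5, -, h7⟩ := H4 fun x => (hp.1 x).lt_of_ne' (hpos x (hg' x))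
        exact (renyi_one_le_iff hgp hpos hgq fun x _ => (h5 x).ne').2 h7
      · rw [renyi_of_not_supp le_rfl hpos]; exact le_top
    · refine ⟨(renyi_le_iff_of_one_lt h1 hp.1 hg0 hpg (fun x _ => hg' x) hq.1 hg0 hqg
        (fun x _ => hg' x)).2 (H2 α h1), ?_⟩
      by_cases hpos : ∀ x, g x ≠ 0 → p x ≠ 0
      · obtain ⟨h5, h6, -⟩ := H4 fun x => (hp.1 x).lt_of_ne' (hpos x (hg' x))
        exact (renyi_le_iff_of_one_lt h1 hg0 hp.1 hgp hpos hg0 hq.1 hgq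
          fun x _ => (h5 x).ne').2 (h6 α h1)
      · rw [renyi_of_not_supp h1.le hpos]; exact le_top

end Renyi

section Necessity

variable {I : Type} [Fintype I]

/-- `p` can be transformed exactly into `q` by a catalytic map that preserves `g`. -/
def CatalyticallyTransforms (p q g : I → ℝ) : Prop :=
  ∃ (R : Type) (_ : Fintype R) (r₁ r₂ : R → ℝ),
    IsProb r₁ ∧ IsProb r₂ ∧ (∀ z, r₁ z ≠ 0 → r₂ z ≠ 0) ∧
    ∃ T : I × R → I × R → ℝ, IsStoch T ∧
      (∀ y, ∑ x, T y x * kron p r₁ x = kron q r₁ y) ∧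
      (∀ y, ∑ x, T y x * kron g r₂ x = kron g r₂ y)

theorem kron_nonneg {I J : Type} {p : I → ℝ} {r : J → ℝ} (hp : ∀ x, 0 ≤ p x) (hr : ∀ x, 0 ≤ r x)
    (x : I × J) : 0 ≤ kron p r x := mul_nonneg (hp _) (hr _)

theorem CatalyticallyTransforms.powerSum_le {p q g : I → ℝ} (H : CatalyticallyTransforms p q g)
    (hp : IsProb p) (hq : IsProb q) (hg : ∀ x, 0 < g x) :
    (∀ α : ℝ, 0 < α → α < 1 → powerSum α p g ≤ powerSum α q g) ∧
    (∀ α : ℝ, 1 < α → powerSum α q g ≤ powerSum α p g) ∧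
    ((∀ x, 0 < p x) → (∀ x, 0 < q x) ∧ ∀ α : ℝ, 1 < α → powerSum α g q ≤ powerSum α g p) := by
  obtain ⟨R, _, r, s, hr, hs, hrs, T, hT, hTp, hTg⟩ := H
  have hg0 : ∀ x, 0 ≤ g x := fun x => (hg x).le
  obtain ⟨z, hz⟩ := hr.exists_ne_zero
  have hrspos : ∀ α, 0 < powerSum α r s := fun α =>
    powerSum_pos α hr.1 hs.1 ⟨z, hz, hrs z hz⟩
  refine ⟨fun α h0 h1 => ?_, fun α h1 => ?_, fun hpos => ?_⟩
  · have := powerSum_le_of_stoch h0 h1 hT (kron_nonneg hp.1 hr.1) (kron_nonneg hg0 hs.1) hTp hTg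
    rw [powerSum_kron α hp.1 hg0 hr.1 hs.1, powerSum_kron α hq.1 hg0 hr.1 hs.1] at this
    exact le_of_mul_le_mul_right this (hrspos α)
  · have := stoch_powerSum_le h1 hT (kron_nonneg hp.1 hr.1) (kron_nonneg hg0 hs.1)
      (fun x hx => mul_ne_zero (hg _).ne' (hrs _ (right_ne_zero_of_mul hx))) hTp hTg
    rw [powerSum_kron α hp.1 hg0 hr.1 hs.1, powerSum_kron α hq.1 hg0 hr.1 hs.1] at this
    exact le_of_mul_le_mul_right this (hrspos α)
  · set s' : R → ℝ := fun z => if r z ≠ 0 then s z else 0 with hs'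
    have hs'0 : ∀ z, 0 ≤ s' z := fun z => by
      simp only [hs']; split_ifs; exacts [hs.1 z, le_rfl]
    have hk : ∀ (x : I × R) (_ : Decidable (r x.2 ≠ 0)),
        (if r x.2 ≠ 0 then kron g s x else 0) = kron g s' x := fun x _ => by
      simp only [kron, hs']; split_ifs <;> simp
    have hcross : ∀ x y : I × R, r x.2 ≠ 0 → ¬ r y.2 ≠ 0 → T y x = 0 := by
      intro x y hx hy
      rw [not_not] at hy
      have h1 : ∑ x, T y x * kron p r x = 0 := by rw [hTp y, kron, hy, mul_zero]
      have h2 := (Finset.sum_eq_zero_iff_of_nonneg (fun x _ =>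
        mul_nonneg (hT.1 y x) (kron_nonneg hp.1 hr.1 x))).1 h1 x (Finset.mem_univ _)
      exact (mul_eq_zero.1 h2).resolve_right (mul_ne_zero (hpos _).ne' hx)
    have hTg' : ∀ y, ∑ x, T y x * kron g s' x = kron g s' y := fun y => by
      have := stoch_fixes_restrict hT (kron_nonneg hg0 hs.1) hTg (fun x => r x.2 ≠ 0) hcross y
      simp only [hk] at this
      exact this
    have hs'z : s' z ≠ 0 := by
      simp only [hs', if_pos hz]; exact hrs z hz
    have hsupp : ∀ x, kron g s' x ≠ 0 → kron p r x ≠ 0 := fun x hx =>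
      mul_ne_zero (hpos _).ne' fun hc => right_ne_zero_of_mul hx (by simp [hs', hc])
    constructor
    · intro i
      refine (hq.1 i).lt_of_ne' fun hc => ?_
      have h1 : ∑ x, T (i, z) x * kron p r x = 0 := by rw [hTp, kron, hc, zero_mul]
      have h2 : ∑ x, T (i, z) x * kron g s' x = 0 := by
        refine Finset.sum_eq_zero fun x _ => ?_
        have h3 := (Finset.sum_eq_zero_iff_of_nonneg (fun x _ =>
          mul_nonneg (hT.1 (i, z) x) (kron_nonneg hp.1 hr.1 x))).1 h1 x (Finset.mem_univ _)
        rcases mul_eq_zero.1 h3 with h | h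
        · rw [h, zero_mul]
        · by_cases h4 : kron g s' x = 0
          · rw [h4, mul_zero]
          · exact absurd h (hsupp x h4)
      rw [hTg'] at h2
      exact mul_ne_zero (hg i).ne' hs'z h2
    · intro α h1
      have := stoch_powerSum_le h1 hT (kron_nonneg hg0 hs'0) (kron_nonneg hp.1 hr.1) hsupp hTg' hTp
      rw [powerSum_kron α hg0 hp.1 hs'0 hr.1, powerSum_kron α hg0 hq.1 hs'0 hr.1] at this
      exact le_of_mul_le_mul_right this (powerSum_pos α hs'0 hr.1 ⟨z, hs'z, hz⟩)

theorem abs_sub_le_dist1 (p q : I → ℝ) (i : I) : |p i - q i| ≤ dist1 p q :=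
  Finset.single_le_sum (f := fun i => |p i - q i|) (fun _ _ => abs_nonneg _) (Finset.mem_univ i)

theorem momentDominates_of_approx {p q g : I → ℝ} (hp : IsProb p) (hq : IsProb q) (hgp : IsProb g)
    (hg : ∀ x, 0 < g x)
    (H : ∀ ε : ℝ, 0 < ε → ∃ q' : I → ℝ, IsProb q' ∧ dist1 q q' ≤ ε ∧
      CatalyticallyTransforms p q' g) :
    MomentDominates p q g := by
  choose! f hf1 hf2 hf3 using H
  set u : ℕ → I → ℝ := fun k => f (1 / ((k : ℝ) + 1)) with hu
  have hk : ∀ k : ℕ, 0 < 1 / ((k : ℝ) + 1) := fun k => Nat.one_div_pos_of_nat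
  have hlim : ∀ i, Filter.Tendsto (fun k => u k i) Filter.atTop (nhds (q i)) := by
    intro i
    rw [tendsto_iff_norm_sub_tendsto_zero]
    refine squeeze_zero (fun _ => norm_nonneg _) (fun k => ?_)
      (tendsto_one_div_add_atTop_nhds_zero_nat (𝕜 := ℝ))
    rw [Real.norm_eq_abs, abs_sub_comm]
    exact (abs_sub_le_dist1 q (u k) i).trans (hf2 _ (hk k))
  have hP := fun k => (hf3 _ (hk k)).powerSum_le hp (hf1 _ (hk k)) hg
  have hcont : ∀ α : ℝ, 0 < α →
      Filter.Tendsto (fun k => powerSum α (u k) g) Filter.atTop (nhds (powerSum α q g)) := by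
    intro α hα
    refine tendsto_finsetSum _ fun i _ => Filter.Tendsto.mul_const _ ?_
    exact (Real.continuousAt_rpow_const _ _ (Or.inr hα.le)).tendsto.comp (hlim i)
  have h2 : ∀ α : ℝ, 1 < α → powerSum α q g ≤ powerSum α p g := fun α h1 =>
    le_of_tendsto' (hcont α (by linarith)) fun k => (hP k).2.1 α h1
  refine ⟨fun α h0 h1 => ge_of_tendsto' (hcont α h0) fun k => (hP k).1 α h0 h1, h2,
    klSum_le_of_powerSum_le hp.1 hg hq.1 hg (by rw [hp.2, hq.2]) h2, fun hpos => ?_⟩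
  have hqpos : ∀ i, 0 < q i := by
    intro i
    refine (hq.1 i).lt_of_ne' fun hc => ?_
    have hl := hlim i
    rw [hc] at hl
    have hb : ∀ k, g i ^ 2 ≤ powerSum 2 g p * u k i := by
      intro k
      obtain ⟨h3, h4⟩ := (hP k).2.2 hpos
      have h5 : g i ^ (2 : ℝ) * u k i ^ (1 - 2 : ℝ) ≤ powerSum 2 g p :=
        (Finset.single_le_sum (f := fun i => g i ^ (2 : ℝ) * u k i ^ (1 - 2 : ℝ))
          (fun j _ => mul_nonneg (Real.rpow_nonneg (hg j).le _) (Real.rpow_nonneg (h3 j).le _))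
          (Finset.mem_univ i)).trans (h4 2 (by norm_num))
      have e : (1 - 2 : ℝ) = -1 := by norm_num
      rw [e, Real.rpow_neg_one, Real.rpow_two, ← div_eq_mul_inv, div_le_iff₀ (h3 i)] at h5
      exact h5
    have := ge_of_tendsto' (hl.const_mul (powerSum 2 g p)) hb
    rw [mul_zero] at this
    exact absurd this (not_le.2 (pow_pos (hg i) 2))
  have h6 : ∀ α : ℝ, 1 < α → powerSum α g q ≤ powerSum α g p := by
    intro α h1
    refine le_of_tendsto' (f := fun k => powerSum α g (u k)) (x := Filter.atTop) ?_
      fun k => ((hP k).2.2 hpos).2 α h1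
    refine tendsto_finsetSum _ fun i _ => Filter.Tendsto.const_mul _ ?_
    exact (Real.continuousAt_rpow_const _ _ (Or.inl (hqpos i).ne')).tendsto.comp (hlim i)
  exact ⟨hqpos, h6, klSum_le_of_powerSum_le hgp.1 hpos hgp.1 hqpos rfl h6⟩

end Necessity

section Blackwell

/-- A function with a supporting line at every point agrees on any finite set with a sum of an
affine function and nonnegative multiples of hinge functions. -/
theorem exists_hinge_interpolant {φ : ℝ → ℝ}
    (hφ : ∀ m, ∃ c d : ℝ, (∀ t, c * t + d ≤ φ t) ∧ c * m + d = φ m) {C : (ℝ → ℝ) → Prop}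
    (hline : ∀ c d : ℝ, C fun t => c * t + d)
    (hhinge : ∀ (ψ : ℝ → ℝ) (c τ : ℝ), 0 ≤ c → C ψ → C fun t => ψ t + c * max (t - τ) 0)
    (X : Finset ℝ) :
    ∃ ψ, C ψ ∧ (∀ t ∈ X, ψ t = φ t) ∧
      ∃ c d : ℝ, ∀ τ, (∀ t ∈ X, t ≤ τ) → ψ τ = c * τ + d ∧ c * τ + d ≤ φ τ := by
  induction X using Finset.induction_on_max with
  | empty =>
    obtain ⟨c, d, h1, -⟩ := hφ 0
    exact ⟨_, hline c d, by simp, c, d, fun τ _ => ⟨rfl, h1 τ⟩⟩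
  | insert m X hm ih =>
    obtain ⟨c', d', h1, h2⟩ := hφ m
    rcases X.eq_empty_or_nonempty with rfl | hX
    · exact ⟨_, hline c' d', by simpa using h2, c', d', fun τ _ => ⟨rfl, h1 τ⟩⟩
    · obtain ⟨ψ, hC, hψ, c, d, hcd⟩ := ih
      set τ₀ := X.max' hX
      have hτX : τ₀ ∈ X := X.max'_mem hX
      have hle : ∀ t ∈ X, t ≤ τ₀ := fun t ht => X.le_max' t ht
      have hlt : τ₀ < m := hm _ hτX
      have e0 := (hcd τ₀ hle).1
      rw [hψ _ hτX] at e0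
      obtain ⟨e1, e2⟩ := hcd m fun t ht => (hm t ht).le
      have hpos : 0 < m - τ₀ := sub_pos.2 hlt
      obtain ⟨k, hk⟩ : ∃ k, k = (φ m - (c * m + d)) / (m - τ₀) := ⟨_, rfl⟩
      have hk0 : 0 ≤ k := hk ▸ div_nonneg (sub_nonneg.2 e2) hpos.le
      have hkm : k * (m - τ₀) = φ m - (c * m + d) := by rw [hk, div_mul_cancel₀ _ hpos.ne']
      have hslope : c + k ≤ c' := by
        have h3 := h1 τ₀
        have : (c + k) * (m - τ₀) ≤ c' * (m - τ₀) := by nlinarith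
        exact le_of_mul_le_mul_right this hpos
      refine ⟨_, hhinge ψ k τ₀ hk0 hC, ?_, c + k, d - k * τ₀, ?_⟩
      · intro t ht
        rcases Finset.mem_insert.1 ht with rfl | ht
        · rw [max_eq_left hpos.le, hkm, e1]; ring
        · rw [max_eq_right (sub_nonpos.2 (hle t ht)), hψ t ht]; ring
      · intro τ hτ
        have hmτ : m ≤ τ := hτ m (Finset.mem_insert_self _ _)
        obtain ⟨e3, -⟩ := hcd τ fun t ht => (hm t ht).le.trans hmτ
        refine ⟨?_, ?_⟩
        · rw [max_eq_left (by linarith), e3]; ring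
        · have h3 := h1 τ
          nlinarith [mul_le_mul_of_nonneg_right hslope (sub_nonneg.2 hmτ)]

variable {I J : Type} [Fintype I] [Fintype J]

/-- Hinge inequalities between two finite weighted families imply the inequality for every
function with supporting lines. -/
theorem sum_mul_le_of_hinge {P G : I → ℝ} {Q H : J → ℝ} (hG : ∀ x, 0 < G x) (hH : ∀ y, 0 < H y)
    (h1 : ∑ y, Q y = ∑ x, P x) (h2 : ∑ y, H y = ∑ x, G x)
    (hh : ∀ τ : ℝ, ∑ y, max (Q y - τ * H y) 0 ≤ ∑ x, max (P x - τ * G x) 0) {φ : ℝ → ℝ}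
    (hφ : ∀ m, ∃ c d : ℝ, (∀ t, c * t + d ≤ φ t) ∧ c * m + d = φ m) :
    ∑ y, H y * φ (Q y / H y) ≤ ∑ x, G x * φ (P x / G x) := by
  have e : ∀ {a b : ℝ} (τ : ℝ), 0 < b → b * max (a / b - τ) 0 = max (a - τ * b) 0 := by
    intro a b τ hb
    rw [mul_max_of_nonneg _ _ hb.le, mul_zero]
    congr 1
    field_simp
  have hline : ∀ c d : ℝ, ∑ y, H y * (c * (Q y / H y) + d) ≤ ∑ x, G x * (c * (P x / G x) + d) := by
    intro c d
    have e1 : ∀ {a b : ℝ}, 0 < b → b * (c * (a / b) + d) = c * a + d * b := by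
      intro a b hb; field_simp
    simp only [e1 (hH _), e1 (hG _), Finset.sum_add_distrib, ← Finset.mul_sum, h1, h2, le_refl]
  obtain ⟨ψ, hC, hψ, -⟩ := exists_hinge_interpolant hφ
    (C := fun ψ => ∑ y, H y * ψ (Q y / H y) ≤ ∑ x, G x * ψ (P x / G x)) hline
    (fun ψ c τ hc hψ => by
      simp only [mul_add, Finset.sum_add_distrib]
      refine add_le_add hψ ?_
      simp only [mul_left_comm _ c, ← Finset.mul_sum, e τ (hH _), e τ (hG _)]
      exact mul_le_mul_of_nonneg_left (hh τ) hc)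
    (Finset.univ.image (fun y => Q y / H y) ∪ Finset.univ.image (fun x => P x / G x))
  have e1 : ∀ y, ψ (Q y / H y) = φ (Q y / H y) := fun y => hψ _ (by simp)
  have e2 : ∀ x, ψ (P x / G x) = φ (P x / G x) := fun x => hψ _ (by simp)
  simpa only [e1, e2] using hC

/-- Blackwell's theorem for dichotomies, in terms of hinge functions. -/
theorem exists_stoch_of_hinge [Nonempty J] {P G : I → ℝ} {Q H : J → ℝ} (hG : ∀ x, 0 < G x)
    (hH : ∀ y, 0 < H y) (h1 : ∑ y, Q y = ∑ x, P x) (h2 : ∑ y, H y = ∑ x, G x)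
    (hh : ∀ τ : ℝ, ∑ y, max (Q y - τ * H y) 0 ≤ ∑ x, max (P x - τ * G x) 0) :
    ∃ T : J → I → ℝ, IsStoch T ∧ (∀ y, ∑ x, T y x * P x = Q y) ∧
      ∀ y, ∑ x, T y x * G x = H y := by
  set L : (J → I → ℝ) → (J → ℝ) × (J → ℝ) :=
    fun T => (fun y => ∑ x, T y x * P x, fun y => ∑ x, T y x * G x) with hL
  have hLc : Continuous L := by fun_prop
  have hcpt : IsCompact {T : J → I → ℝ | IsStoch T} := by
    have hc : IsCompact (Set.univ.pi fun _ : J => Set.univ.pi fun _ : I => Set.Icc (0 : ℝ) 1) :=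
      isCompact_univ_pi fun _ => isCompact_univ_pi fun _ => isCompact_Icc
    refine hc.of_isClosed_subset ?_ ?_
    · have : {T : J → I → ℝ | IsStoch T}
          = (⋂ y, ⋂ x, {T | 0 ≤ T y x}) ∩ ⋂ x, {T | ∑ y, T y x = 1} := by
        ext T; simp [IsStoch]
      rw [this]
      refine IsClosed.inter ?_ ?_
      · exact isClosed_iInter fun y => isClosed_iInter fun x =>
          isClosed_le continuous_const (by fun_prop)
      · exact isClosed_iInter fun x => isClosed_eq (by fun_prop) continuous_const
    · intro T hT y _ x _
      refine ⟨hT.1 y x, ?_⟩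
      rw [← hT.2 x]
      exact Finset.single_le_sum (f := fun y => T y x) (fun y _ => hT.1 y x) (Finset.mem_univ y)
  have hconv : Convex ℝ (L '' {T : J → I → ℝ | IsStoch T}) := by
    rintro _ ⟨T, hT, rfl⟩ _ ⟨T', hT', rfl⟩ a b ha hb hab
    refine ⟨fun y x => a * T y x + b * T' y x, ⟨fun y x => ?_, fun x => ?_⟩, ?_⟩
    · exact add_nonneg (mul_nonneg ha (hT.1 y x)) (mul_nonneg hb (hT'.1 y x))
    · rw [Finset.sum_add_distrib, ← Finset.mul_sum, ← Finset.mul_sum, hT.2, hT'.2, mul_one,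
        mul_one, hab]
    · ext y <;>
      · simp only [hL, Prod.fst_add, Prod.snd_add, Prod.smul_fst, Prod.smul_snd, Pi.add_apply,
          Pi.smul_apply, smul_eq_mul, Finset.mul_sum, ← Finset.sum_add_distrib]
        exact Finset.sum_congr rfl fun x _ => by ring
  by_contra hno
  have hnot : (Q, H) ∉ L '' {T : J → I → ℝ | IsStoch T} := by
    rintro ⟨T, hT, hTL⟩
    exact hno ⟨T, hT, fun y => congrFun (congrArg Prod.fst hTL) y,
      fun y => congrFun (congrArg Prod.snd hTL) y⟩
  obtain ⟨f, u, hf1, hf2⟩ := geometric_hahn_banach_closed_point hconv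
    (hcpt.image hLc).isClosed hnot
  obtain ⟨a, b, hab⟩ : ∃ a b : J → ℝ, ∀ v w : J → ℝ, f (v, w) = ∑ y, (a y * v y + b y * w y) := by
    refine ⟨fun y => f (fun j => if y = j then 1 else 0, 0),
      fun y => f (0, fun j => if y = j then 1 else 0), fun v w => ?_⟩
    have e : (v, w) = (v, (0 : J → ℝ)) + ((0 : J → ℝ), w) := by simp
    rw [e, map_add, Finset.sum_add_distrib]
    have e1 := LinearMap.pi_apply_eq_sum_univ
      ((f : (J → ℝ) × (J → ℝ) →ₗ[ℝ] ℝ) ∘ₗ LinearMap.inl ℝ (J → ℝ) (J → ℝ)) v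
    have e2 := LinearMap.pi_apply_eq_sum_univ
      ((f : (J → ℝ) × (J → ℝ) →ₗ[ℝ] ℝ) ∘ₗ LinearMap.inr ℝ (J → ℝ) (J → ℝ)) w
    simp only [LinearMap.comp_apply, LinearMap.inl_apply, LinearMap.inr_apply, smul_eq_mul,
      ContinuousLinearMap.coe_coe] at e1 e2
    rw [e1, e2]
    simp only [mul_comm]
  have hmax : ∀ t : ℝ, ∃ y, ∀ y', a y' * t + b y' ≤ a y * t + b y := fun t =>
    Finite.exists_max fun y => a y * t + b y
  choose m hm using hmax
  have key := sum_mul_le_of_hinge hG hH h1 h2 hh (φ := fun t => a (m t) * t + b (m t))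
    (fun t => ⟨a (m t), b (m t), fun s => hm s _, rfl⟩)
  have hT := hf1 _ ⟨fun y x => if y = m (P x / G x) then 1 else 0,
    ⟨fun y x => by dsimp only; split_ifs <;> norm_num, fun x => by simp⟩, rfl⟩
  have lt := hT.trans hf2
  simp only [hL, hab] at lt
  refine absurd lt (not_lt.2 ?_)
  calc ∑ y, (a y * Q y + b y * H y)
      ≤ ∑ y, H y * (a (m (Q y / H y)) * (Q y / H y) + b (m (Q y / H y))) := by
        refine Finset.sum_le_sum fun y _ => ?_
        have e : a y * Q y + b y * H y = H y * (a y * (Q y / H y) + b y) := by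
          have := (hH y).ne'
          field_simp
        rw [e]
        exact mul_le_mul_of_nonneg_left (hm _ y) (hH y).le
    _ ≤ ∑ x, G x * (a (m (P x / G x)) * (P x / G x) + b (m (P x / G x))) := key
    _ = ∑ x, ∑ y, (if y = m (P x / G x) then 1 else 0) * (a y * P x + b y * G x) := by
        refine Finset.sum_congr rfl fun x _ => ?_
        have := (hG x).ne'
        simp only [ite_mul, one_mul, zero_mul, Finset.sum_ite_eq',
          Finset.mem_univ, if_true]
        field_simp
    _ = _ := by
        rw [Finset.sum_comm]
        refine Finset.sum_congr rfl fun y _ => ?_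
        rw [Finset.mul_sum, Finset.mul_sum, ← Finset.sum_add_distrib]
        exact Finset.sum_congr rfl fun x _ => by ring

end Blackwell

section PositiveKernel

open Filter Topology

/-- If `D ≥ 0` on `[b, ∞)` and `D v > 0` for some `v > b`, then exponentially tilted integrals of
`D` are positive for large tilting, whatever the lower end of integration. -/
theorem exists_tilt_integral_pos {D : ℝ → ℝ} (hD : Continuous D) {a b v : ℝ} (hab : a ≤ b)
    (ha : ∀ u ≤ a, 0 ≤ D u) (hb : ∀ u, b ≤ u → 0 ≤ D u) (hv : b < v) (hDv : 0 < D v) :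
    ∃ t Λ : ℝ, v < t ∧ ∀ lam, Λ ≤ lam → ∀ γ : ℝ → ℝ, Continuous γ → (∀ x, 0 ≤ γ x) →
      (∀ x, γ x ≤ 1) → (∀ x ∈ Set.Icc v t, 1 / 2 ≤ γ x) → ∀ s₀ s₁, s₀ ≤ b → t ≤ s₁ →
      0 < ∫ x in s₀..s₁, D x * (Real.exp (lam * x) * γ x) := by
  obtain ⟨t, hvt, ht⟩ : ∃ t, v < t ∧ ∀ x ∈ Set.Icc v t, D v / 2 ≤ D x := by
    have h1 : ∀ᶠ x in 𝓝 v, D v / 2 < D x :=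
      hD.continuousAt.eventually (lt_mem_nhds (half_lt_self hDv))
    obtain ⟨δ, hδ, h2⟩ := Metric.eventually_nhds_iff.1 h1
    refine ⟨v + δ / 2, by linarith, fun x hx => (h2 ?_).le⟩
    rw [Real.dist_eq, abs_of_nonneg (by linarith [hx.1])]
    linarith [hx.2]
  obtain ⟨C, hC0, hC⟩ : ∃ C, 0 ≤ C ∧ ∀ x ∈ Set.Icc a b, -C ≤ D x := by
    obtain ⟨m, hm⟩ := (isCompact_Icc.image hD).bddBelow (s := D '' Set.Icc a b)
    refine ⟨max (-m) 0, le_max_right _ _, fun x hx => ?_⟩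
    have := hm (Set.mem_image_of_mem D hx)
    linarith [le_max_left (-m) 0]
  have hvb : 0 < v - b := sub_pos.2 hv
  have htv : 0 < t - v := sub_pos.2 hvt
  have hq : 0 < (t - v) * (D v / 4) := by positivity
  refine ⟨t, (b - a) * C / ((t - v) * (D v / 4)) / (v - b), hvt, ?_⟩
  intro lam hlam γ hγ hγ0 hγ1 hγ2 s₀ s₁ hs₀ hs₁
  have hba : 0 ≤ b - a := sub_nonneg.2 hab
  have hlam0 : 0 ≤ lam := le_trans (by positivity) hlam
  set f : ℝ → ℝ := fun x => D x * (Real.exp (lam * x) * γ x) with hf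
  have hfc : Continuous f := by fun_prop
  have hfi : ∀ x y, IntervalIntegrable f MeasureTheory.volume x y := fun x y =>
    hfc.intervalIntegrable x y
  have hw : ∀ x, 0 ≤ Real.exp (lam * x) * γ x := fun x => mul_nonneg (Real.exp_pos _).le (hγ0 x)
  have hfa : ∀ u ≤ a, 0 ≤ f u := fun u hu => mul_nonneg (ha u hu) (hw u)
  have hfb : ∀ u, b ≤ u → 0 ≤ f u := fun u hu => mul_nonneg (hb u hu) (hw u)
  have i1 : -((b - a) * (C * Real.exp (lam * b))) ≤ ∫ x in s₀..b, f x := by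
    have hE : 0 ≤ C * Real.exp (lam * b) := by positivity
    have low : ∀ x ∈ Set.Icc a b, -(C * Real.exp (lam * b)) ≤ f x := by
      intro x hx
      have h1 : Real.exp (lam * x) * γ x ≤ Real.exp (lam * b) := by
        calc Real.exp (lam * x) * γ x ≤ Real.exp (lam * x) * 1 :=
              mul_le_mul_of_nonneg_left (hγ1 x) (Real.exp_pos _).le
          _ ≤ _ := by
              rw [mul_one]
              exact Real.exp_le_exp.2 (mul_le_mul_of_nonneg_left hx.2 hlam0)
      have h2 := mul_le_mul_of_nonneg_right (hC x hx) (hw x)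
      have h3 := mul_le_mul_of_nonneg_left h1 hC0
      simp only [hf]
      linarith
    have hm : ∀ s, a ≤ s → s ≤ b → -((b - a) * (C * Real.exp (lam * b))) ≤ ∫ x in s..b, f x := by
      intro s h1 h2
      have h3 := intervalIntegral.integral_mono_on (μ := MeasureTheory.volume) h2
        (_root_.intervalIntegrable_const (c := -(C * Real.exp (lam * b)))) (hfi s b)
        fun x hx => low x ⟨h1.trans hx.1, hx.2⟩
      rw [intervalIntegral.integral_const, smul_eq_mul] at h3
      nlinarith
    rcases le_total s₀ a with h | h
    · rw [← intervalIntegral.integral_add_adjacent_intervals (hfi s₀ a) (hfi a b)]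
      have := intervalIntegral.integral_nonneg (μ := MeasureTheory.volume) h
        fun x hx => hfa x hx.2
      linarith [hm a le_rfl hab]
    · exact hm s₀ h hs₀
  have i2 : 0 ≤ ∫ x in b..v, f x := intervalIntegral.integral_nonneg hv.le fun x hx => hfb x hx.1
  have i4 : 0 ≤ ∫ x in t..s₁, f x :=
    intervalIntegral.integral_nonneg hs₁ fun x hx => hfb x (by linarith [hx.1])
  have i3 : (t - v) * (D v / 4 * Real.exp (lam * v)) ≤ ∫ x in v..t, f x := by
    have h3 := intervalIntegral.integral_mono_on (μ := MeasureTheory.volume) hvt.le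
      (_root_.intervalIntegrable_const (c := D v / 4 * Real.exp (lam * v))) (hfi v t) ?_
    · rwa [intervalIntegral.integral_const, smul_eq_mul] at h3
    · intro x hx
      have h1 : Real.exp (lam * v) * (1 / 2) ≤ Real.exp (lam * x) * γ x :=
        mul_le_mul (Real.exp_le_exp.2 (mul_le_mul_of_nonneg_left hx.1 hlam0)) (hγ2 x hx)
          (by norm_num) (Real.exp_pos _).le
      have h2 := mul_le_mul (ht x hx) h1 (by positivity) (le_trans (by positivity) (ht x hx))
      simp only [hf]
      linarith
  have hsum : ∫ x in s₀..s₁, f x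
      = (∫ x in s₀..b, f x) + (∫ x in b..v, f x) + (∫ x in v..t, f x) + ∫ x in t..s₁, f x := by
    rw [intervalIntegral.integral_add_adjacent_intervals (hfi s₀ b) (hfi b v),
      intervalIntegral.integral_add_adjacent_intervals (hfi s₀ v) (hfi v t),
      intervalIntegral.integral_add_adjacent_intervals (hfi s₀ t) (hfi t s₁)]
  have hcmp : (b - a) * (C * Real.exp (lam * b)) < (t - v) * (D v / 4 * Real.exp (lam * v)) := by
    rw [div_le_iff₀ hvb, div_le_iff₀ hq] at hlam
    have h1 : lam * (v - b) < Real.exp (lam * (v - b)) := by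
      linarith [Real.add_one_le_exp (lam * (v - b))]
    have h2 : (b - a) * C < Real.exp (lam * (v - b)) * ((t - v) * (D v / 4)) :=
      hlam.trans_lt (mul_lt_mul_of_pos_right h1 hq)
    have h3 := mul_lt_mul_of_pos_right h2 (Real.exp_pos (lam * b))
    have h4 : Real.exp (lam * v) = Real.exp (lam * (v - b)) * Real.exp (lam * b) := by
      rw [← Real.exp_add]; ring_nf
    rw [h4]
    linarith
  rw [hsum]
  linarith

theorem integral_le_of_nonneg_outside {f : ℝ → ℝ} (hf : Continuous f) {a b s t s' t' : ℝ}
    (ha : ∀ u ≤ a, 0 ≤ f u) (hb : ∀ u, b ≤ u → 0 ≤ f u) (hs : s ≤ a) (ht : b ≤ t)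
    (hs' : s' ≤ s) (ht' : t ≤ t') : ∫ x in s..t, f x ≤ ∫ x in s'..t', f x := by
  have hfi : ∀ x y, IntervalIntegrable f MeasureTheory.volume x y := fun x y =>
    hf.intervalIntegrable x y
  have e : ∫ x in s'..t', f x
      = (∫ x in s'..s, f x) + (∫ x in s..t, f x) + ∫ x in t..t', f x := by
    rw [intervalIntegral.integral_add_adjacent_intervals (hfi s' s) (hfi s t),
      intervalIntegral.integral_add_adjacent_intervals (hfi s' t) (hfi t t')]
  have h1 : 0 ≤ ∫ x in s'..s, f x :=
    intervalIntegral.integral_nonneg hs' fun x hx => ha x (hx.2.trans hs)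
  have h2 : 0 ≤ ∫ x in t..t', f x :=
    intervalIntegral.integral_nonneg ht' fun x hx => hb x (ht.trans hx.1)
  linarith

theorem exists_uniform_integral_pos {D : ℝ → ℝ} (hD : Continuous D) {a b : ℝ}
    (ha : ∀ u ≤ a, 0 ≤ D u) (hb : ∀ u, b ≤ u → 0 ≤ D u)
    (hL : ∀ lam : ℝ, ∃ s t : ℝ, s ≤ a ∧ b ≤ t ∧ 0 < ∫ x in s..t, D x * Real.exp (lam * x))
    {K : Set ℝ} (hK : IsCompact K) :
    ∃ M₀ : ℝ, ∀ M, M₀ ≤ M → ∀ lam ∈ K, 0 < ∫ x in (-M)..M, D x * Real.exp (lam * x) := by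
  refine hK.induction_on (p := fun K => ∃ M₀ : ℝ, ∀ M, M₀ ≤ M → ∀ lam ∈ K,
    0 < ∫ x in (-M)..M, D x * Real.exp (lam * x)) ⟨0, by simp⟩ ?_ ?_ ?_
  · rintro s t hst ⟨M₀, h⟩
    exact ⟨M₀, fun M hM lam hlam => h M hM lam (hst hlam)⟩
  · rintro s t ⟨M₀, h⟩ ⟨M₁, h'⟩
    refine ⟨max M₀ M₁, fun M hM lam hlam => ?_⟩
    rcases hlam with hlam | hlam
    · exact h M ((le_max_left _ _).trans hM) lam hlam
    · exact h' M ((le_max_right _ _).trans hM) lam hlam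
  · intro lam _
    obtain ⟨s, t, hs, ht, hpos⟩ := hL lam
    have hc : Continuous fun l : ℝ => ∫ x in s..t, D x * Real.exp (l * x) :=
      intervalIntegral.continuous_parametric_intervalIntegral_of_continuous'
        (f := fun l x => D x * Real.exp (l * x)) (by unfold Function.uncurry; fun_prop) s t
    refine ⟨_, mem_nhdsWithin_of_mem_nhds (hc.continuousAt.eventually (lt_mem_nhds hpos)),
      max |s| |t|, fun M hM l hl => lt_of_lt_of_le hl ?_⟩
    have h1 := (le_max_left _ _).trans hM
    have h2 := (le_max_right _ _).trans hM
    exact integral_le_of_nonneg_outside (by fun_prop)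
      (fun u hu => mul_nonneg (ha u hu) (Real.exp_pos _).le)
      (fun u hu => mul_nonneg (hb u hu) (Real.exp_pos _).le) hs ht
      (by linarith [neg_abs_le s]) (by linarith [le_abs_self t])

/-- Convolution with a wide truncated Gaussian makes `D` positive. -/
theorem exists_gaussian_convolution_pos {D : ℝ → ℝ} (hD : Continuous D) {a b u v : ℝ} (hab : a ≤ b)
    (ha : ∀ x ≤ a, 0 ≤ D x) (hb : ∀ x, b ≤ x → 0 ≤ D x) (hu : u < a) (hDu : 0 < D u)
    (hv : b < v) (hDv : 0 < D v)
    (hL : ∀ lam : ℝ, ∃ s t : ℝ, s ≤ a ∧ b ≤ t ∧ 0 < ∫ x in s..t, D x * Real.exp (lam * x)) :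
    ∃ B κ : ℝ, 0 < B ∧ ∀ s ∈ Set.Icc (a - B) (b + B),
      0 < ∫ z in (-B)..B, D (s - z) * Real.exp (-κ * z ^ 2) := by
  obtain ⟨t, Λ, hvt, htop⟩ := exists_tilt_integral_pos hD hab ha hb hv hDv
  obtain ⟨t', Λ', hvt', hbot⟩ := exists_tilt_integral_pos (D := fun x => D (-x)) (a := -b)
    (b := -a) (v := -u) (by fun_prop) (by linarith) (fun x hx => hb _ (by linarith))
    (fun x hx => ha _ (by linarith)) (by linarith) (by simpa using hDu)
  obtain ⟨l₀, hl1, hl2, hl3⟩ : ∃ l₀ : ℝ, 1 ≤ l₀ ∧ Λ ≤ l₀ - 1 ∧ Λ' ≤ l₀ - 1 := by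
    refine ⟨max 1 (max (Λ + 1) (Λ' + 1)), le_max_left _ _, ?_, ?_⟩
    · have := (le_max_left (Λ + 1) (Λ' + 1)).trans (le_max_right 1 _); linarith
    · have := (le_max_right (Λ + 1) (Λ' + 1)).trans (le_max_right 1 _); linarith
  obtain ⟨M₀, hM₀⟩ := exists_uniform_integral_pos hD ha hb hL (isCompact_Icc (a := -l₀) (b := l₀))
  obtain ⟨M, hM1, hM2, hMa, hMb, hMt, hMt'⟩ : ∃ M : ℝ, 1 ≤ M ∧ M₀ ≤ M ∧ |a| ≤ M ∧ |b| ≤ M ∧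
      t ≤ M ∧ t' ≤ M := by
    refine ⟨1 + |M₀| + |a| + |b| + |t| + |t'|, ?_, ?_, ?_, ?_, ?_, ?_⟩ <;>
    linarith [abs_nonneg M₀, abs_nonneg a, abs_nonneg b, abs_nonneg t, abs_nonneg t',
      le_abs_self M₀, le_abs_self t, le_abs_self t']
  have hmid := hM₀ M hM2
  have hMa' := abs_le.1 hMa
  have hMb' := abs_le.1 hMb
  have hev : ∀ᶠ κ in 𝓝 (0 : ℝ), ∀ lam ∈ Set.Icc (-l₀) l₀,
      0 < ∫ x in (-M)..M, D x * (Real.exp (lam * x) * Real.exp (-κ * x ^ 2)) := by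
    refine isCompact_Icc.eventually_forall_of_forall_eventually
      (P := fun κ lam => 0 < ∫ x in (-M)..M, D x * (Real.exp (lam * x) * Real.exp (-κ * x ^ 2))) ?_
    intro lam hlam
    have hc : Continuous fun y : ℝ × ℝ =>
        ∫ x in (-M)..M, D x * (Real.exp (y.2 * x) * Real.exp (-y.1 * x ^ 2)) :=
      intervalIntegral.continuous_parametric_intervalIntegral_of_continuous'
        (f := fun (y : ℝ × ℝ) x => D x * (Real.exp (y.2 * x) * Real.exp (-y.1 * x ^ 2)))
        (by unfold Function.uncurry; fun_prop) (-M) M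
    refine hc.continuousAt.eventually (lt_mem_nhds ?_)
    simpa using hmid lam hlam
  obtain ⟨κ₀, hκ₀, hball⟩ := Metric.eventually_nhds_iff.1 hev
  obtain ⟨κ, hκ, hκ1, hκ2⟩ : ∃ κ : ℝ, 0 < κ ∧ κ < κ₀ ∧ 2 * (κ * M ^ 2) ≤ 1 := by
    have hM : 0 < M := by linarith
    refine ⟨min (κ₀ / 2) (1 / (2 * M ^ 2)), by positivity, ?_, ?_⟩
    · exact (min_le_left _ _).trans_lt (by linarith)
    · have := mul_le_mul_of_nonneg_right (min_le_right (κ₀ / 2) (1 / (2 * M ^ 2)))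
        (by positivity : (0 : ℝ) ≤ 2 * M ^ 2)
      rw [div_mul_cancel₀ _ (by positivity)] at this
      linarith
  have hgauss := hball (y := κ) (by rw [Real.dist_eq, sub_zero, abs_of_pos hκ]; exact hκ1)
  have hκM : 2 * κ * M ≤ 1 := by nlinarith
  obtain ⟨B, hB⟩ : ∃ B : ℝ, 2 * κ * B = l₀ := ⟨l₀ / (2 * κ), by field_simp⟩
  have hBM : M ≤ B := by
    have : 2 * κ * M ≤ 2 * κ * B := by linarith
    exact le_of_mul_le_mul_left this (by linarith)
  have hγ0 : ∀ x : ℝ, 0 ≤ Real.exp (-κ * x ^ 2) := fun x => (Real.exp_pos _).le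
  have hγ1 : ∀ x : ℝ, Real.exp (-κ * x ^ 2) ≤ 1 := fun x => by
    rw [Real.exp_le_one_iff]; nlinarith [sq_nonneg x]
  have hγ2 : ∀ x : ℝ, -M ≤ x → x ≤ M → 1 / 2 ≤ Real.exp (-κ * x ^ 2) := fun x h1 h2 => by
    have h3 : x ^ 2 ≤ M ^ 2 := sq_le_sq' h1 h2
    have h4 := Real.add_one_le_exp (-κ * x ^ 2)
    nlinarith
  refine ⟨B, κ, by linarith, fun s hs => ?_⟩
  have hexp : ∀ z, D (s - z) * Real.exp (-κ * z ^ 2) = Real.exp (-κ * s ^ 2) *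
      (fun x => D x * (Real.exp (2 * κ * s * x) * Real.exp (-κ * x ^ 2))) (s - z) := by
    intro z
    simp only
    rw [mul_left_comm, ← Real.exp_add, ← Real.exp_add]
    ring_nf
  simp only [hexp]
  rw [intervalIntegral.integral_const_mul]
  refine mul_pos (Real.exp_pos _) ?_
  have hsub := intervalIntegral.integral_comp_sub_left (a := -B) (b := B)
    (fun x => D x * (Real.exp (2 * κ * s * x) * Real.exp (-κ * x ^ 2))) s
  rw [sub_neg_eq_add] at hsub
  rw [hsub]
  rcases lt_or_ge (B - M) s with h1 | h1
  · refine htop _ ?_ _ (by fun_prop) hγ0 hγ1 (fun x hx => hγ2 x ?_ ?_) _ _ (by linarith [hs.2])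
      (by linarith)
    · nlinarith
    · linarith [hx.1]
    · linarith [hx.2]
  rcases lt_or_ge s (-(B - M)) with h2 | h2
  · have h3 := hbot (2 * κ * (-s)) (by nlinarith) (fun x => Real.exp (-κ * x ^ 2)) (by fun_prop)
      hγ0 hγ1 (fun x hx => hγ2 x (by linarith [hx.1]) (by linarith [hx.2])) (-s - B) (-s + B)
      (by linarith [hs.1]) (by linarith)
    have h4 := intervalIntegral.integral_comp_neg (a := -s - B) (b := -s + B)
      fun x => D x * (Real.exp (2 * κ * s * x) * Real.exp (-κ * x ^ 2))
    have e1 : -(-s + B) = s - B := by ring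
    have e2 : -(-s - B) = s + B := by ring
    rw [e1, e2] at h4
    rw [← h4]
    simpa only [neg_sq, mul_neg, neg_mul] using h3
  · refine (hgauss (2 * κ * s) ⟨by nlinarith, by nlinarith⟩).trans_le ?_
    exact integral_le_of_nonneg_outside (by fun_prop)
      (fun x hx => mul_nonneg (ha x hx) (mul_pos (Real.exp_pos _) (Real.exp_pos _)).le)
      (fun x hx => mul_nonneg (hb x hx) (mul_pos (Real.exp_pos _) (Real.exp_pos _)).le)
      (by linarith) (by linarith) (by linarith) (by linarith)

theorem exists_riemann_sum_nonneg {f : ℝ × ℝ → ℝ} (hf : Continuous f) {B s₀ s₁ : ℝ} (hB : 0 < B)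
    (hs : s₀ ≤ s₁) (hpos : ∀ s ∈ Set.Icc s₀ s₁, 0 < ∫ z in (-B)..B, f (s, z)) :
    ∃ N : ℕ, 0 < N ∧ ∀ s ∈ Set.Icc s₀ s₁,
      0 ≤ ∑ k ∈ Finset.range N, f (s, -B + 2 * B / N * k) := by
  have hc : Continuous fun s : ℝ => ∫ z in (-B)..B, f (s, z) :=
    intervalIntegral.continuous_parametric_intervalIntegral_of_continuous'
      (f := fun s z => f (s, z)) (by unfold Function.uncurry; fun_prop) (-B) B
  obtain ⟨sm, hsm, hmin⟩ := isCompact_Icc.exists_isMinOn (Set.nonempty_Icc.2 hs) hc.continuousOn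
  set c := ∫ z in (-B)..B, f (sm, z) with hcdef
  have hcpos : 0 < c := hpos sm hsm
  have huc := (isCompact_Icc.prod isCompact_Icc).uniformContinuousOn_of_continuous
    (s := Set.Icc s₀ s₁ ×ˢ Set.Icc (-B) B) hf.continuousOn
  obtain ⟨δ, hδ, hδ2⟩ := Metric.uniformContinuousOn_iff.1 huc (c / (2 * B)) (by positivity)
  obtain ⟨N, hN⟩ := exists_nat_gt (2 * B / δ)
  have hN0' : (0 : ℝ) < N := lt_trans (by positivity) hN
  have hN0 : 0 < N := by exact_mod_cast hN0'
  refine ⟨N, hN0, fun s hs' => ?_⟩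
  set h := 2 * B / N with hh
  have hh0 : 0 < h := by positivity
  have hhδ : h < δ := by
    rw [hh, div_lt_iff₀ hN0']; rw [div_lt_iff₀ hδ] at hN; linarith
  have hhN : h * N = 2 * B := by rw [hh]; field_simp
  have hsum := intervalIntegral.sum_integral_adjacent_intervals (μ := MeasureTheory.volume)
    (f := fun z => f (s, z)) (a := fun k : ℕ => -B + h * k) (n := N)
    fun k _ => (by fun_prop : Continuous fun z => f (s, z)).intervalIntegrable _ _
  simp only [Nat.cast_zero, mul_zero, add_zero, hhN] at hsum
  have e : -B + 2 * B = B := by ring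
  rw [e] at hsum
  have hle : ∀ k ∈ Finset.range N, (∫ z in (-B + h * (k : ℕ))..(-B + h * ((k + 1 : ℕ) : ℝ)), f (s, z))
      ≤ h * (f (s, -B + h * k) + c / (2 * B)) := by
    intro k hk
    have hk' : (k : ℝ) + 1 ≤ N := by exact_mod_cast Finset.mem_range.1 hk
    have hkN : h * (k + 1) ≤ 2 * B := by rw [← hhN]; exact mul_le_mul_of_nonneg_left hk' hh0.le
    have hk0 : 0 ≤ h * (k : ℝ) := by positivity
    push_cast
    have h2 : -B + h * (k : ℝ) ≤ -B + h * (k + 1) := by nlinarith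
    have h3 := intervalIntegral.integral_mono_on (μ := MeasureTheory.volume) h2
      ((by fun_prop : Continuous fun z => f (s, z)).intervalIntegrable _ _)
      (_root_.intervalIntegrable_const (c := f (s, -B + h * k) + c / (2 * B))) ?_
    · rw [intervalIntegral.integral_const, smul_eq_mul] at h3
      refine h3.trans (le_of_eq ?_)
      ring
    · intro z hz
      have h4 := hδ2 (s, z) ⟨hs', by linarith [hz.1], by linarith [hz.2]⟩ (s, -B + h * k)
        ⟨hs', by linarith, by linarith⟩ ?_
      · rw [Real.dist_eq] at h4
        linarith [(abs_lt.1 h4).2]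
      · rw [Prod.dist_eq, dist_self, max_lt_iff]
        refine ⟨hδ, ?_⟩
        rw [Real.dist_eq, abs_of_nonneg (by linarith [hz.1])]
        linarith [hz.2]
  have htot := Finset.sum_le_sum hle
  rw [hsum, ← Finset.mul_sum, Finset.sum_add_distrib, Finset.sum_const, Finset.card_range,
    nsmul_eq_mul, mul_add, ← mul_assoc h, hhN, mul_div_cancel₀ _ (by positivity)] at htot
  have hcs : c ≤ ∫ z in (-B)..B, f (s, z) := hmin hs'
  have : 0 ≤ h * ∑ k ∈ Finset.range N, f (s, -B + h * k) := by linarith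
  exact nonneg_of_mul_nonneg_right this hh0

theorem exists_finite_kernel {D : ℝ → ℝ} (hD : Continuous D) {a b u v : ℝ} (hab : a ≤ b)
    (ha : ∀ x ≤ a, 0 ≤ D x) (hb : ∀ x, b ≤ x → 0 ≤ D x) (hu : u < a) (hDu : 0 < D u)
    (hv : b < v) (hDv : 0 < D v)
    (hL : ∀ lam : ℝ, ∃ s t : ℝ, s ≤ a ∧ b ≤ t ∧ 0 < ∫ x in s..t, D x * Real.exp (lam * x)) :
    ∃ (N : ℕ) (w z : Fin N → ℝ), 0 < N ∧ (∀ k, 0 < w k) ∧ ∀ s, 0 ≤ ∑ k, w k * D (s - z k) := by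
  obtain ⟨B, κ, hB, hpos⟩ := exists_gaussian_convolution_pos hD hab ha hb hu hDu hv hDv hL
  obtain ⟨N, hN, hsum⟩ := exists_riemann_sum_nonneg
    (f := fun y => D (y.1 - y.2) * Real.exp (-κ * y.2 ^ 2)) (by fun_prop) hB (by linarith) hpos
  have hN0 : (0 : ℝ) < N := by exact_mod_cast hN
  refine ⟨N, fun k => Real.exp (-κ * (-B + 2 * B / N * (k : ℕ)) ^ 2),
    fun k => -B + 2 * B / N * (k : ℕ), hN, fun k => Real.exp_pos _, fun s => ?_⟩
  by_cases hs : s ∈ Set.Icc (a - B) (b + B)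
  · have := hsum s hs
    rw [Finset.sum_range] at this
    simpa only [mul_comm (Real.exp _)] using this
  · refine Finset.sum_nonneg fun k _ => mul_nonneg (Real.exp_pos _).le ?_
    have hk : ((k : ℕ) : ℝ) ≤ N := by exact_mod_cast k.2.le
    have h1 : 0 ≤ 2 * B / N * ((k : ℕ) : ℝ) := by positivity
    have h2 : 2 * B / N * ((k : ℕ) : ℝ) ≤ 2 * B := by
      rw [div_mul_eq_mul_div, div_le_iff₀ hN0]
      exact mul_le_mul_of_nonneg_left hk (by linarith)
    rw [Set.mem_Icc, not_and_or, not_le, not_le] at hs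
    rcases hs with hs | hs
    · exact ha _ (by linarith)
    · exact hb _ (by linarith)

end PositiveKernel

section HingeSum

open Filter Topology

variable {I : Type} [Fintype I]

/-- The hinge divergence of `p` from `exp u • g`. -/
def hingeSum (p g : I → ℝ) (u : ℝ) : ℝ := ∑ x, max (p x - Real.exp u * g x) 0

@[fun_prop]
theorem continuous_hingeSum (p g : I → ℝ) : Continuous (hingeSum p g) := by
  unfold hingeSum
  fun_prop

theorem hingeSum_nonneg (p g : I → ℝ) (u : ℝ) : 0 ≤ hingeSum p g u :=
  Finset.sum_nonneg fun _ _ => le_max_right _ _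

theorem le_of_forall_mul_pow_le {c x M : ℝ} (hc : 0 < c) (hM : 0 < M)
    (h : ∀ k : ℕ, 2 ≤ k → c * x ^ k ≤ M ^ k) : x ≤ M := by
  by_contra! hx
  have h1 : 1 < x / M := (one_lt_div hM).2 hx
  obtain ⟨k, hk⟩ := pow_unbounded_of_one_lt (1 / c) h1
  have h2 : (x / M) ^ k ≤ (x / M) ^ (k + 2) := pow_le_pow_right₀ h1.le (by omega)
  have h3 := h (k + 2) (by omega)
  have h4 : 1 / c < x ^ (k + 2) / M ^ (k + 2) := by
    rw [← div_pow]; linarith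
  rw [div_lt_div_iff₀ hc (by positivity)] at h4
  linarith

theorem le_mul_of_powerSum_le {p g q h : I → ℝ} {M : ℝ} (hM : 0 < M) (hp : ∀ x, 0 ≤ p x)
    (hg : ∀ x, 0 < g x) (hg1 : ∑ x, g x = 1) (hq : ∀ x, 0 ≤ q x) (hh : ∀ x, 0 < h x)
    (H : ∀ α : ℝ, 1 < α → powerSum α q h ≤ powerSum α p g) (hpM : ∀ x, p x ≤ M * g x) (x : I) :
    q x ≤ M * h x := by
  have key : ∀ {a b : ℝ} (k : ℕ), 0 ≤ a → 0 < b →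
      a ^ (k : ℝ) * b ^ (1 - (k : ℝ)) = b * (a / b) ^ k := by
    intro a b k ha hb
    rw [Real.rpow_sub hb, Real.rpow_one, Real.rpow_natCast, Real.rpow_natCast, div_pow]
    ring
  rw [← div_le_iff₀ (hh x)]
  refine le_of_forall_mul_pow_le (hh x) hM fun k hk => ?_
  have h1 := H k (by exact_mod_cast (show 1 < k by omega))
  have h2 : h x * (q x / h x) ^ k ≤ powerSum k q h := by
    rw [← key k (hq x) (hh x), powerSum]
    exact Finset.single_le_sum (f := fun x => q x ^ (k : ℝ) * h x ^ (1 - (k : ℝ)))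
      (fun i _ => mul_nonneg (Real.rpow_nonneg (hq i) _) (Real.rpow_nonneg (hh i).le _))
      (Finset.mem_univ x)
  have h3 : powerSum k p g ≤ M ^ k := by
    calc powerSum k p g ≤ ∑ x, g x * M ^ k := by
          rw [powerSum]
          refine Finset.sum_le_sum fun i _ => ?_
          rw [key k (hp i) (hg i)]
          refine mul_le_mul_of_nonneg_left (pow_le_pow_left₀ (div_nonneg (hp i) (hg i).le) ?_ k)
            (hg i).le
          rw [div_le_iff₀ (hg i)]
          exact hpM i
      _ = M ^ k := by rw [← Finset.sum_mul, hg1, one_mul]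
  linarith

/-- The tilted integral of a hinge function, in terms of antiderivatives of the exponentials. -/
theorem integral_hinge_mul_exp {lam p g s t : ℝ} {A B : ℝ → ℝ}
    (hA : ∀ u, HasDerivAt A (Real.exp (lam * u)) u)
    (hB : ∀ u, HasDerivAt B (Real.exp ((lam + 1) * u)) u) (hp : 0 ≤ p) (hg : 0 < g)
    (hst : p ≠ 0 → s ≤ Real.log (p / g) ∧ Real.log (p / g) ≤ t) :
    ∫ u in s..t, max (p - Real.exp u * g) 0 * Real.exp (lam * u)
      = (if p = 0 then 0 else p * A (Real.log (p / g)) - g * B (Real.log (p / g)))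
        - p * A s + g * B s - B s * (if p = 0 then g else 0) := by
  by_cases h0 : p = 0
  · subst h0
    have : ∀ u : ℝ, max (0 - Real.exp u * g) 0 = 0 := fun u =>
      max_eq_right (by have := mul_pos (Real.exp_pos u) hg; linarith)
    simp only [this]
    simp
    ring
  obtain ⟨h1, h2⟩ := hst h0
  have hp' : 0 < p := lt_of_le_of_ne hp (Ne.symm h0)
  simp only [h0, if_false]
  set L := Real.log (p / g) with hL
  have hLe : Real.exp L = p / g := Real.exp_log (by positivity)
  have hLg : Real.exp L * g = p := by rw [hLe]; field_simp
  have hfi : ∀ x y, IntervalIntegrable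
      (fun u => max (p - Real.exp u * g) 0 * Real.exp (lam * u)) MeasureTheory.volume x y :=
    fun x y => (by fun_prop : Continuous fun u =>
      max (p - Real.exp u * g) 0 * Real.exp (lam * u)).intervalIntegrable x y
  rw [← intervalIntegral.integral_add_adjacent_intervals (hfi s L) (hfi L t)]
  have e1 : ∫ u in L..t, max (p - Real.exp u * g) 0 * Real.exp (lam * u) = 0 := by
    refine (intervalIntegral.integral_congr (g := fun _ => 0) fun u hu => ?_).trans (by simp)
    rw [Set.uIcc_of_le h2] at hu
    have := mul_le_mul_of_nonneg_right (Real.exp_le_exp.2 hu.1) hg.le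
    simp only
    rw [max_eq_right (by linarith), zero_mul]
  have e2 : ∫ u in s..L, max (p - Real.exp u * g) 0 * Real.exp (lam * u)
      = (p * A L - g * B L) - (p * A s - g * B s) := by
    refine (intervalIntegral.integral_congr
      (g := fun u => p * Real.exp (lam * u) - g * Real.exp ((lam + 1) * u)) fun u hu => ?_).trans ?_
    · rw [Set.uIcc_of_le h1] at hu
      have := mul_le_mul_of_nonneg_right (Real.exp_le_exp.2 hu.2) hg.le
      simp only
      rw [max_eq_left (by linarith), add_mul, Real.exp_add, one_mul]
      ring
    · exact intervalIntegral.integral_eq_sub_of_hasDerivAt (f := fun u => p * A u - g * B u)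
        (fun u _ => ((hA u).const_mul p).sub ((hB u).const_mul g))
        ((by fun_prop : Continuous fun u => p * Real.exp (lam * u)
          - g * Real.exp ((lam + 1) * u)).intervalIntegrable _ _)
  rw [e1, e2]
  ring

/-- The boundary term at the upper end in `integral_hinge_mul_exp`. -/
def hingeMoment (A B : ℝ → ℝ) (p g : I → ℝ) : ℝ :=
  ∑ x, if p x = 0 then 0 else p x * A (Real.log (p x / g x)) - g x * B (Real.log (p x / g x))

theorem integral_hingeSum_mul_exp {lam s t : ℝ} {A B : ℝ → ℝ} {p g : I → ℝ}
    (hA : ∀ u, HasDerivAt A (Real.exp (lam * u)) u)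
    (hB : ∀ u, HasDerivAt B (Real.exp ((lam + 1) * u)) u) (hp : IsProb p) (hg : ∀ x, 0 < g x)
    (hst : ∀ x, p x ≠ 0 → s ≤ Real.log (p x / g x) ∧ Real.log (p x / g x) ≤ t) :
    ∫ u in s..t, hingeSum p g u * Real.exp (lam * u)
      = hingeMoment A B p g - A s + (∑ x, g x) * B s
        - B s * ∑ x, (if p x = 0 then g x else 0) := by
  simp only [hingeSum, Finset.sum_mul]
  rw [intervalIntegral.integral_finsetSum]
  · rw [Finset.sum_congr rfl fun x _ => integral_hinge_mul_exp hA hB (hp.1 x) (hg x) (hst x),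
      Finset.sum_sub_distrib, Finset.sum_add_distrib, Finset.sum_sub_distrib, ← Finset.sum_mul,
      hp.2, one_mul, ← Finset.mul_sum]
    rfl
  · intro x _
    exact (by fun_prop : Continuous fun u =>
      max (p x - Real.exp u * g x) 0 * Real.exp (lam * u)).intervalIntegrable _ _

theorem eventually_neg_le_integral_hingeSum_sub {lam t η : ℝ} {A B : ℝ → ℝ} {p q g : I → ℝ}
    (hA : ∀ u, HasDerivAt A (Real.exp (lam * u)) u)
    (hB : ∀ u, HasDerivAt B (Real.exp ((lam + 1) * u)) u) (hp : IsProb p) (hq : IsProb q)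
    (hg : ∀ x, 0 < g x) (hpt : ∀ x, p x ≠ 0 → Real.log (p x / g x) ≤ t)
    (hqt : ∀ x, q x ≠ 0 → Real.log (q x / g x) ≤ t)
    (hmom : hingeMoment A B q g ≤ hingeMoment A B p g)
    (hlim : Tendsto (fun s => B s * (∑ x, (if p x = 0 then g x else 0)
      - ∑ x, (if q x = 0 then g x else 0))) atBot (𝓝 0)) (hη : 0 < η) :
    ∀ᶠ s in atBot, -η ≤ ∫ u in s..t, (hingeSum p g u - hingeSum q g u) * Real.exp (lam * u) := by
  have h1 : ∀ᶠ s in atBot, ∀ x, s ≤ Real.log (p x / g x) :=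
    eventually_all.2 fun x => eventually_le_atBot _
  have h2 : ∀ᶠ s in atBot, ∀ x, s ≤ Real.log (q x / g x) :=
    eventually_all.2 fun x => eventually_le_atBot _
  filter_upwards [h1, h2, hlim.eventually (gt_mem_nhds hη)] with s hs1 hs2 hs3
  simp only [sub_mul]
  rw [intervalIntegral.integral_sub
    ((by fun_prop : Continuous fun u => hingeSum p g u * Real.exp (lam * u)).intervalIntegrable _ _)
    ((by fun_prop : Continuous fun u => hingeSum q g u * Real.exp (lam * u)).intervalIntegrable _ _),
    integral_hingeSum_mul_exp hA hB hp hg fun x hx => ⟨hs1 x, hpt x hx⟩,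
    integral_hingeSum_mul_exp hA hB hq hg fun x hx => ⟨hs2 x, hqt x hx⟩]
  rw [mul_sub] at hs3
  linarith

theorem hingeMoment_exp {lam : ℝ} (h0 : lam ≠ 0) (h1 : lam + 1 ≠ 0) {p g : I → ℝ}
    (hp : ∀ x, 0 ≤ p x) (hg : ∀ x, 0 < g x) :
    hingeMoment (fun u => Real.exp (lam * u) / lam)
      (fun u => Real.exp ((lam + 1) * u) / (lam + 1)) p g
      = powerSum (lam + 1) p g / (lam * (lam + 1)) := by
  rw [hingeMoment, powerSum, Finset.sum_div]
  refine Finset.sum_congr rfl fun x _ => ?_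
  split_ifs with h
  · rw [h, Real.zero_rpow h1]; simp
  have hpx : 0 < p x := lt_of_le_of_ne (hp x) (Ne.symm h)
  have hr : 0 < p x / g x := div_pos hpx (hg x)
  have e : ∀ c : ℝ, Real.exp (c * Real.log (p x / g x)) = p x ^ c * g x ^ (-c) := by
    intro c
    rw [mul_comm, ← Real.rpow_def_of_pos hr, Real.div_rpow hpx.le (hg x).le,
      Real.rpow_neg (hg x).le, div_eq_mul_inv]
  have e1 : p x ^ (lam + 1) = p x ^ lam * p x := by rw [Real.rpow_add hpx, Real.rpow_one]
  have e2 : g x ^ (1 - (lam + 1)) = g x ^ (-lam) := by congr 1; ring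
  have e3 : g x ^ (-lam) = g x ^ (-(lam + 1)) * g x := by
    nth_rewrite 3 [← Real.rpow_one (g x)]
    rw [← Real.rpow_add (hg x)]
    congr 1
    ring
  rw [e, e, e2, e1, e3]
  field_simp
  ring

theorem MomentDominates.exists_antiderivatives {p q g : I → ℝ} (H : MomentDominates p q g)
    (hp : IsProb p) (hq : IsProb q) (hg : ∀ x, 0 < g x) {lam : ℝ}
    (hlam : -1 < lam ∨ ∀ x, 0 < p x) :
    ∃ A B : ℝ → ℝ, (∀ u, HasDerivAt A (Real.exp (lam * u)) u) ∧
      (∀ u, HasDerivAt B (Real.exp ((lam + 1) * u)) u) ∧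
      hingeMoment A B q g ≤ hingeMoment A B p g ∧
      Tendsto (fun s => B s * (∑ x, (if p x = 0 then g x else 0)
        - ∑ x, (if q x = 0 then g x else 0))) atBot (𝓝 0) := by
  obtain ⟨H1, H2, H3, H4⟩ := H
  have hexp : ∀ c : ℝ, c ≠ 0 → ∀ u, HasDerivAt (fun u => Real.exp (c * u) / c) (Real.exp (c * u)) u := by
    intro c hc u
    have := (((hasDerivAt_id u).const_mul c).exp).div_const c
    simpa only [id_eq, mul_one, mul_div_cancel_right₀ _ hc] using this
  have hlim : ∀ B : ℝ → ℝ, (-1 < lam → Tendsto B atBot (𝓝 0)) →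
      Tendsto (fun s => B s * (∑ x, (if p x = 0 then g x else 0)
        - ∑ x, (if q x = 0 then g x else 0))) atBot (𝓝 0) := by
    intro B hB
    rcases hlam with h | h
    · simpa using (hB h).mul_const _
    · have h1 : ∀ x, p x ≠ 0 := fun x => (h x).ne'
      have h2 : ∀ x, q x ≠ 0 := fun x => ((H4 h).1 x).ne'
      simp [h1, h2]
  have hlimexp : -1 < lam →
      Tendsto (fun u => Real.exp ((lam + 1) * u) / (lam + 1)) atBot (𝓝 0) := by
    intro h
    have h1 : Tendsto (fun u : ℝ => (lam + 1) * u) atBot atBot :=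
      tendsto_id.const_mul_atBot (by linarith)
    simpa using (Real.tendsto_exp_atBot.comp h1).div_const (lam + 1)
  by_cases h0 : lam = 0
  · subst h0
    refine ⟨fun u => u, fun u => Real.exp ((0 + 1) * u) / (0 + 1), fun u => ?_,
      hexp _ (by norm_num), ?_, hlim _ hlimexp⟩
    · simpa using hasDerivAt_id' u
    · have e : ∀ r : I → ℝ, IsProb r → hingeMoment (fun u => u)
          (fun u => Real.exp ((0 + 1) * u) / (0 + 1)) r g
          = ∑ x, r x * Real.log (r x / g x) - 1 := by
        intro r hr
        have e0 : ∑ x, r x * Real.log (r x / g x) - 1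
            = ∑ x, (r x * Real.log (r x / g x) - r x) := by
          rw [Finset.sum_sub_distrib, hr.2]
        rw [e0, hingeMoment]
        refine Finset.sum_congr rfl fun x _ => ?_
        split_ifs with h
        · simp [h]
        · have : 0 < r x := lt_of_le_of_ne (hr.1 x) (Ne.symm h)
          simp only [zero_add, one_mul, div_one]
          rw [Real.exp_log (div_pos this (hg x)), mul_div_cancel₀ _ (hg x).ne']
      rw [e p hp, e q hq]
      linarith
  by_cases h1 : lam + 1 = 0
  · have hl : lam = -1 := by linarith
    have hfull : ∀ x, 0 < p x := hlam.resolve_left (by linarith)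
    subst hl
    obtain ⟨hqf, -, hkl⟩ := H4 hfull
    refine ⟨fun u => Real.exp (-1 * u) / -1, fun u => u, hexp _ (by norm_num), fun u => ?_, ?_,
      hlim _ fun h => absurd h (lt_irrefl _)⟩
    · simpa using hasDerivAt_id' u
    · have e : ∀ r : I → ℝ, (∀ x, 0 < r x) → hingeMoment (fun u => Real.exp (-1 * u) / -1)
          (fun u => u) r g = ∑ x, g x * Real.log (g x / r x) - ∑ x, g x := by
        intro r hr
        rw [← Finset.sum_sub_distrib, hingeMoment]
        refine Finset.sum_congr rfl fun x _ => ?_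
        rw [if_neg (hr x).ne', neg_one_mul, Real.exp_neg, Real.exp_log (div_pos (hr x) (hg x)),
          ← inv_div (r x), Real.log_inv, inv_div]
        have := (hr x).ne'
        field_simp
        ring
      rw [e p hfull, e q hqf]
      linarith
  refine ⟨_, _, hexp lam h0, hexp (lam + 1) h1, ?_, hlim _ hlimexp⟩
  rw [hingeMoment_exp h0 h1 hp.1 hg, hingeMoment_exp h0 h1 hq.1 hg]
  rcases lt_or_gt_of_ne h1 with h | h
  · obtain ⟨-, h2, -⟩ := H4 (hlam.resolve_left (by linarith))
    have := h2 (1 - (lam + 1)) (by linarith)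
    rw [powerSum_swap, powerSum_swap] at this
    exact div_le_div_of_nonneg_right this (by nlinarith)
  rcases lt_or_gt_of_ne h0 with h' | h'
  · exact div_le_div_of_nonpos_of_le (by nlinarith) (H1 _ h (by linarith))
  · exact div_le_div_of_nonneg_right (H2 _ (by linarith)) (by nlinarith)

end HingeSum

section Sufficiency

open Filter Topology

variable {I : Type} [Fintype I]

/-- The vector `q` mixed with a fraction `ε` of `g`. -/
def mixWith (ε : ℝ) (q g : I → ℝ) : I → ℝ := fun x => (1 - ε) * q x + ε * g x

theorem IsProb.mixWith {ε : ℝ} (h0 : 0 ≤ ε) (h1 : ε ≤ 1) {q g : I → ℝ} (hq : IsProb q)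
    (hg : IsProb g) : IsProb (mixWith ε q g) := by
  refine ⟨fun x => add_nonneg (mul_nonneg (by linarith) (hq.1 x)) (mul_nonneg h0 (hg.1 x)), ?_⟩
  simp only [_root_.mixWith, Finset.sum_add_distrib, ← Finset.mul_sum, hq.2, hg.2]
  ring

theorem dist1_mixWith_le {ε : ℝ} (h0 : 0 ≤ ε) {q g : I → ℝ} (hq : IsProb q) (hg : IsProb g) :
    dist1 q (mixWith ε q g) ≤ 2 * ε := by
  calc dist1 q (mixWith ε q g) ≤ ∑ x, ε * (q x + g x) := by
        refine Finset.sum_le_sum fun x _ => ?_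
        have e : q x - mixWith ε q g x = ε * (q x - g x) := by simp only [mixWith]; ring
        rw [e, abs_mul, abs_of_nonneg h0]
        refine mul_le_mul_of_nonneg_left (abs_le.2 ⟨?_, ?_⟩) h0 <;>
        linarith [hq.1 x, hg.1 x]
    _ = 2 * ε := by
        rw [← Finset.mul_sum, Finset.sum_add_distrib, hq.2, hg.2]; ring

theorem hingeSum_mixWith_le {ε : ℝ} (h0 : 0 ≤ ε) (h1 : ε ≤ 1) (q g : I → ℝ) (u : ℝ) :
    hingeSum (mixWith ε q g) g u ≤ (1 - ε) * hingeSum q g u + ε * hingeSum g g u := by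
  simp only [hingeSum, Finset.mul_sum, ← Finset.sum_add_distrib]
  refine Finset.sum_le_sum fun x _ => max_le ?_ (add_nonneg (mul_nonneg (by linarith)
    (le_max_right _ _)) (mul_nonneg h0 (le_max_right _ _)))
  have h2 := mul_le_mul_of_nonneg_left (le_max_left (q x - Real.exp u * g x) 0)
    (by linarith : 0 ≤ 1 - ε)
  have h3 := mul_le_mul_of_nonneg_left (le_max_left (g x - Real.exp u * g x) 0) h0
  simp only [mixWith]
  linarith

theorem hingeSum_self {g : I → ℝ} (hg : IsProb g) (u : ℝ) :
    hingeSum g g u = max (1 - Real.exp u) 0 := by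
  have e : ∀ x, max (g x - Real.exp u * g x) 0 = g x * max (1 - Real.exp u) 0 := by
    intro x
    rw [mul_max_of_nonneg _ _ (hg.1 x)]
    ring_nf
  simp only [hingeSum, e]
  rw [← Finset.sum_mul, hg.2, one_mul]

theorem one_sub_exp_le_hingeSum {p g : I → ℝ} (hp : IsProb p) (hg : IsProb g) (u : ℝ) :
    1 - Real.exp u ≤ hingeSum p g u := by
  have e : 1 - Real.exp u = ∑ x, (p x - Real.exp u * g x) := by
    rw [Finset.sum_sub_distrib, ← Finset.mul_sum, hp.2, hg.2, mul_one]
  rw [e]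
  exact Finset.sum_le_sum fun x _ => le_max_left _ _

theorem hingeSum_self_le {p g : I → ℝ} (hp : IsProb p) (hg : IsProb g) (u : ℝ) :
    hingeSum g g u ≤ hingeSum p g u := by
  rw [hingeSum_self hg]
  exact max_le (one_sub_exp_le_hingeSum hp hg u) (hingeSum_nonneg _ _ _)

theorem hingeSum_eq_zero {p g : I → ℝ} {u : ℝ} (h : ∀ x, p x ≤ Real.exp u * g x) :
    hingeSum p g u = 0 :=
  Finset.sum_eq_zero fun x _ => max_eq_right (by linarith [h x])

theorem hingeSum_eq_one_sub_exp {p g : I → ℝ} (hp : IsProb p) (hg : IsProb g) {u : ℝ}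
    (h : ∀ x, Real.exp u * g x ≤ p x) : hingeSum p g u = 1 - Real.exp u := by
  have e : 1 - Real.exp u = ∑ x, (p x - Real.exp u * g x) := by
    rw [Finset.sum_sub_distrib, ← Finset.mul_sum, hp.2, hg.2, mul_one]
  rw [e]
  exact Finset.sum_congr rfl fun x _ => max_eq_left (by linarith [h x])

theorem sub_le_hingeSum (p g : I → ℝ) (u : ℝ) (j : I) :
    p j - Real.exp u * g j ≤ hingeSum p g u :=
  (le_max_left _ _).trans (Finset.single_le_sum (f := fun x => max (p x - Real.exp u * g x) 0)
    (fun _ _ => le_max_right _ _) (Finset.mem_univ j))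

/-- The excess of the hinge sum over its trivial lower bound is at least any single deficit. -/
theorem one_sub_exp_add_le_hingeSum {p g : I → ℝ} (hp : IsProb p) (hg : IsProb g) (u : ℝ) (j : I) :
    1 - Real.exp u + (Real.exp u * g j - p j) ≤ hingeSum p g u := by
  have e : 1 - Real.exp u = ∑ x, (p x - Real.exp u * g x) := by
    rw [Finset.sum_sub_distrib, ← Finset.mul_sum, hp.2, hg.2, mul_one]
  have h := Finset.single_le_sum
    (f := fun x => max (p x - Real.exp u * g x) 0 - (p x - Real.exp u * g x))
    (fun _ _ => sub_nonneg.2 (le_max_left _ _)) (Finset.mem_univ j)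
  rw [Finset.sum_sub_distrib, ← e] at h
  have h2 := le_max_right (p j - Real.exp u * g j) 0
  simp only [hingeSum]
  linarith

/-- The tilted integral of the gap between the hinge sums of `p` and of a mixture of `q` with `g`
is positive once the lower end is far out. -/
theorem MomentDominates.exists_integral_hingeSum_sub_pos {p q g : I → ℝ}
    (H : MomentDominates p q g) (hp : IsProb p) (hq : IsProb q) (hgp : IsProb g)
    (hg : ∀ x, 0 < g x) {ε : ℝ} (h0 : 0 < ε) (h1 : ε < 1) {t v : ℝ} (hvt : v ≤ t)
    (hpt : ∀ x, p x ≠ 0 → Real.log (p x / g x) ≤ t)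
    (hqt : ∀ x, q x ≠ 0 → Real.log (q x / g x) ≤ t)
    (hv : hingeSum g g v < hingeSum p g v) {lam : ℝ} (hlam : -1 < lam ∨ ∀ x, 0 < p x) (s₀ : ℝ) :
    ∃ s ≤ s₀, 0 < ∫ u in s..t,
      (hingeSum p g u - hingeSum (mixWith ε q g) g u) * Real.exp (lam * u) := by
  obtain ⟨A, B, hA, hB, hmom, hlim⟩ := H.exists_antiderivatives hp hq hg hlam
  set f : ℝ → ℝ := fun u => (hingeSum p g u - hingeSum g g u) * Real.exp (lam * u) with hf
  have hfc : Continuous f := by fun_prop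
  have hf0 : ∀ u, 0 ≤ f u := fun u =>
    mul_nonneg (sub_nonneg.2 (hingeSum_self_le hp hgp u)) (Real.exp_pos _).le
  have hc : 0 < ∫ u in (v - 1)..t, f u :=
    intervalIntegral.integral_pos (by linarith) hfc.continuousOn (fun u _ => hf0 u)
      ⟨v, ⟨by linarith, hvt⟩, mul_pos (sub_pos.2 hv) (Real.exp_pos _)⟩
  set c := ∫ u in (v - 1)..t, f u with hcdef
  obtain ⟨s, hs1, hs2, hs3⟩ := ((eventually_neg_le_integral_hingeSum_sub hA hB hp hq hg hpt hqt hmom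
    hlim (η := ε * c / 2) (by positivity)).and
    ((eventually_le_atBot s₀).and (eventually_le_atBot (v - 1)))).exists
  refine ⟨s, hs2, ?_⟩
  have h2 : c ≤ ∫ u in s..t, f u := by
    rw [← intervalIntegral.integral_add_adjacent_intervals (hfc.intervalIntegrable s (v - 1))
      (hfc.intervalIntegrable (v - 1) t)]
    have := intervalIntegral.integral_nonneg (μ := MeasureTheory.volume) hs3 fun u _ => hf0 u
    linarith
  have hst : s ≤ t := by linarith
  have h3 := intervalIntegral.integral_mono_on (μ := MeasureTheory.volume)
    (f := fun u => (1 - ε) * ((hingeSum p g u - hingeSum q g u) * Real.exp (lam * u)) + ε * f u)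
    (g := fun u => (hingeSum p g u - hingeSum (mixWith ε q g) g u) * Real.exp (lam * u)) hst
    ((by fun_prop : Continuous _).intervalIntegrable _ _)
    ((by fun_prop : Continuous _).intervalIntegrable _ _) ?_
  · rw [intervalIntegral.integral_add ((by fun_prop : Continuous _).intervalIntegrable _ _)
      ((by fun_prop : Continuous _).intervalIntegrable _ _),
      intervalIntegral.integral_const_mul, intervalIntegral.integral_const_mul] at h3
    have h4 := mul_le_mul_of_nonneg_left hs1 (by linarith : 0 ≤ 1 - ε)
    have h5 := mul_le_mul_of_nonneg_left h2 h0.le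
    have h6 : 0 < ε * c := by positivity
    nlinarith
  · intro u _
    have h4 := hingeSum_mixWith_le h0.le h1.le q g u
    have h5 := mul_le_mul_of_nonneg_right h4 (Real.exp_pos (lam * u)).le
    simp only [hf]
    linarith

theorem exists_one_lt_div {p g : I → ℝ} (hp : IsProb p) (hgp : IsProb g) (hg : ∀ x, 0 < g x)
    (hpg : p ≠ g) : ∃ j, 1 < p j / g j := by
  by_contra! h
  refine hpg (funext fun x => ?_)
  have h1 : ∀ x ∈ Finset.univ, p x ≤ g x := fun x _ => by
    have := h x
    rwa [div_le_one (hg x)] at this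
  exact (Finset.sum_eq_sum_iff_of_le h1).1 (hp.2.trans hgp.2.symm) x (Finset.mem_univ x)

theorem exists_div_lt_one {p g : I → ℝ} (hp : IsProb p) (hgp : IsProb g) (hg : ∀ x, 0 < g x)
    (hpg : p ≠ g) : ∃ j, p j / g j < 1 := by
  by_contra! h
  refine hpg (funext fun x => ?_)
  have h1 : ∀ x ∈ Finset.univ, g x ≤ p x := fun x _ => by
    have := h x
    rwa [one_le_div (hg x)] at this
  exact ((Finset.sum_eq_sum_iff_of_le h1).1 (hgp.2.trans hp.2.symm) x (Finset.mem_univ x)).symm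

theorem MomentDominates.exists_hinge_kernel {p q g : I → ℝ}
    (H : MomentDominates p q g) (hp : IsProb p) (hq : IsProb q) (hgp : IsProb g)
    (hg : ∀ x, 0 < g x) (hpg : p ≠ g) {ε : ℝ} (h0 : 0 < ε) (h1 : ε < 1) :
    ∃ (N : ℕ) (w z : Fin N → ℝ), 0 < N ∧ (∀ k, 0 < w k) ∧ ∀ s, 0 ≤ ∑ k, w k *
      (hingeSum p g (s - z k) - hingeSum (mixWith ε q g) g (s - z k)) := by
  have hne : Nonempty I := ⟨hp.exists_ne_zero.choose⟩
  have h1' : 0 < 1 - ε := by linarith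
  obtain ⟨j, hj⟩ := Finite.exists_max fun x => p x / g x
  obtain ⟨i, hi⟩ := Finite.exists_min fun x => p x / g x
  set M := p j / g j with hM
  set m := p i / g i with hm
  have hM1 : 1 < M := by
    obtain ⟨x, hx⟩ := exists_one_lt_div hp hgp hg hpg
    exact hx.trans_le (hj x)
  have hm1 : m < 1 := by
    obtain ⟨x, hx⟩ := exists_div_lt_one hp hgp hg hpg
    exact (hi x).trans_lt hx
  have hm0 : 0 ≤ m := div_nonneg (hp.1 i) (hg i).le
  have hpM : ∀ x, p x ≤ M * g x := fun x => (div_le_iff₀ (hg x)).1 (hj x)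
  have hpm : ∀ x, m * g x ≤ p x := fun x => (le_div_iff₀ (hg x)).1 (hi x)
  have hqM : ∀ x, q x ≤ M * g x :=
    le_mul_of_powerSum_le (by linarith) hp.1 hg hgp.2 hq.1 hg H.2.1 hpM
  have hqm : ∀ x, m * g x ≤ q x := by
    rcases hm0.eq_or_lt with h | h
    · intro x
      rw [← h, zero_mul]
      exact hq.1 x
    · have hpf : ∀ x, 0 < p x := fun x => (mul_pos h (hg x)).trans_le (hpm x)
      obtain ⟨hqf, H', -⟩ := H.2.2.2 hpf
      intro x
      have := le_mul_of_powerSum_le (inv_pos.2 h) hgp.1 hpf hp.2 hgp.1 hqf H'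
        (fun x => by rw [inv_mul_eq_div, le_div_iff₀ h]; linarith [hpm x]) x
      rw [inv_mul_eq_div, le_div_iff₀ h] at this
      linarith
  have hbpos : 0 < (1 - ε) * M + ε := by nlinarith
  have hapos : 0 < (1 - ε) * m + ε := by nlinarith
  set b := Real.log ((1 - ε) * M + ε) with hb
  set a := Real.log ((1 - ε) * m + ε) with ha
  have hbe : Real.exp b = (1 - ε) * M + ε := Real.exp_log hbpos
  have hae : Real.exp a = (1 - ε) * m + ε := Real.exp_log hapos
  have hb0 : 0 < b := Real.log_pos (by nlinarith)
  have ha0 : a < 0 := Real.log_neg hapos (by nlinarith)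
  have hmixb : ∀ u, b ≤ u → hingeSum (mixWith ε q g) g u = 0 := fun u hu => by
    refine hingeSum_eq_zero fun x => ?_
    have h2 := mul_le_mul_of_nonneg_right (Real.exp_le_exp.2 hu) (hg x).le
    have h3 := mul_le_mul_of_nonneg_left (hqM x) h1'.le
    rw [hbe] at h2
    simp only [mixWith]
    linarith
  have hmixa : ∀ u ≤ a, hingeSum (mixWith ε q g) g u = 1 - Real.exp u := fun u hu => by
    refine hingeSum_eq_one_sub_exp (hq.mixWith h0.le h1.le hgp) hgp fun x => ?_
    have h2 := mul_le_mul_of_nonneg_right (Real.exp_le_exp.2 hu) (hg x).le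
    have h3 := mul_le_mul_of_nonneg_left (hqm x) h1'.le
    rw [hae] at h2
    simp only [mixWith]
    linarith
  set D : ℝ → ℝ := fun u => hingeSum p g u - hingeSum (mixWith ε q g) g u with hD
  have hDb : ∀ u, b ≤ u → 0 ≤ D u := fun u hu => by
    simp only [hD, hmixb u hu, sub_zero]
    exact hingeSum_nonneg _ _ _
  have hDa : ∀ u ≤ a, 0 ≤ D u := fun u hu => by
    simp only [hD, hmixa u hu]
    exact sub_nonneg.2 (one_sub_exp_le_hingeSum hp hgp u)
  obtain ⟨v, hbv, hvM⟩ : ∃ v, b < v ∧ Real.exp v < M := by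
    obtain ⟨y, hy1, hy2⟩ := exists_between (show (1 - ε) * M + ε < M by nlinarith)
    refine ⟨Real.log y, Real.log_lt_log hbpos hy1, ?_⟩
    rwa [Real.exp_log (hbpos.trans hy1)]
  obtain ⟨u, hua, hum⟩ : ∃ u, u < a ∧ m < Real.exp u := by
    obtain ⟨y, hy1, hy2⟩ := exists_between (show m < (1 - ε) * m + ε by nlinarith)
    have hy0 : 0 < y := hm0.trans_lt hy1
    refine ⟨Real.log y, Real.log_lt_log hy0 hy2, ?_⟩
    rwa [Real.exp_log hy0]
  have hFv : 0 < hingeSum p g v := by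
    refine lt_of_lt_of_le ?_ (sub_le_hingeSum p g v j)
    rw [hM, lt_div_iff₀ (hg j)] at hvM
    linarith
  have hDv : 0 < D v := by simpa only [hD, hmixb v hbv.le, sub_zero] using hFv
  have hDu : 0 < D u := by
    have h2 := one_sub_exp_add_le_hingeSum hp hgp u i
    rw [hm, div_lt_iff₀ (hg i)] at hum
    simp only [hD, hmixa u hua.le]
    linarith
  have hlogle : ∀ r : I → ℝ, (∀ x, 0 ≤ r x) → (∀ x, r x ≤ M * g x) → ∀ x, r x ≠ 0 →
      Real.log (r x / g x) ≤ Real.log M := fun r hr hrM x hx =>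
    Real.log_le_log (div_pos (lt_of_le_of_ne (hr x) (Ne.symm hx)) (hg x))
      ((div_le_iff₀ (hg x)).2 (hrM x))
  have hvlog : v ≤ Real.log M := (Real.le_log_iff_exp_le (by linarith)).2 hvM.le
  refine exists_finite_kernel (D := D) (by fun_prop) (ha0.trans hb0).le hDa hDb hua hDu hbv hDv
    fun lam => ?_
  by_cases hlam : -1 < lam ∨ ∀ x, 0 < p x
  · obtain ⟨s, hs, hpos⟩ := H.exists_integral_hingeSum_sub_pos hp hq hgp hg h0 h1 hvlog
      (hlogle p hp.1 hpM) (hlogle q hq.1 hqM) (by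
        rw [hingeSum_self hgp, max_eq_right]
        · exact hFv
        · linarith [Real.one_le_exp (hb0.trans hbv).le]) hlam a
    exact ⟨s, _, hs, hbv.le.trans hvlog, hpos⟩
  · rw [not_or, not_lt, not_forall] at hlam
    obtain ⟨hl, x, hx⟩ := hlam
    have hx0 : p x = 0 := le_antisymm (not_lt.1 hx) (hp.1 x)
    set f : ℝ → ℝ := fun u => D u * Real.exp (lam * u) with hf
    have hfc : Continuous f := by fun_prop
    have hlow : ∀ y ≤ a, g x ≤ f y := fun y hy => by
      have h2 := one_sub_exp_add_le_hingeSum hp hgp y x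
      have h3 : Real.exp y * g x ≤ D y := by
        simp only [hD, hmixa y hy]
        linarith
      have h4 : 1 ≤ Real.exp y * Real.exp (lam * y) := by
        rw [← Real.exp_add]
        exact Real.one_le_exp (by nlinarith)
      have h5 := mul_le_mul_of_nonneg_right h3 (Real.exp_pos (lam * y)).le
      have h6 := mul_le_mul_of_nonneg_right h4 (hg x).le
      simp only [hf]
      linarith
    set c := ∫ y in a..b, f y with hc
    have hcx : 0 ≤ (|c| + 1) / g x := div_nonneg (by positivity) (hg x).le
    refine ⟨a - (|c| + 1) / g x, b, by linarith, le_rfl, ?_⟩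
    change 0 < ∫ y in _..b, f y
    rw [← intervalIntegral.integral_add_adjacent_intervals
      (hfc.intervalIntegrable _ a) (hfc.intervalIntegrable a b), ← hc]
    have h2 := intervalIntegral.integral_mono_on (μ := MeasureTheory.volume)
      (show a - (|c| + 1) / g x ≤ a by linarith)
      (_root_.intervalIntegrable_const (c := g x)) (hfc.intervalIntegrable _ a)
      fun y hy => hlow y hy.2
    rw [intervalIntegral.integral_const, smul_eq_mul, sub_sub_cancel,
      div_mul_cancel₀ _ (hg x).ne'] at h2
    linarith [neg_abs_le c]

/-- A nonnegative kernel sum of gaps of hinge sums yields a catalyst. -/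
theorem catalyticallyTransforms_of_hinge_kernel {p q g : I → ℝ} (hp : IsProb p) (hq : IsProb q)
    (hgp : IsProb g) (hg : ∀ x, 0 < g x) {N : ℕ} {w z : Fin N → ℝ} (hN : 0 < N)
    (hw : ∀ k, 0 < w k)
    (hker : ∀ s, 0 ≤ ∑ k, w k * (hingeSum p g (s - z k) - hingeSum q g (s - z k))) :
    CatalyticallyTransforms p q g := by
  have hne : Nonempty (Fin N) := ⟨⟨0, hN⟩⟩
  have hneI : Nonempty I := ⟨hp.exists_ne_zero.choose⟩
  set v : Fin N → ℝ := fun k => w k * Real.exp (-z k) with hv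
  have hv0 : ∀ k, 0 < v k := fun k => mul_pos (hw k) (Real.exp_pos _)
  set W := ∑ k, w k with hW
  set V := ∑ k, v k with hV
  have hW0 : 0 < W := Finset.sum_pos (fun k _ => hw k) Finset.univ_nonempty
  have hV0 : 0 < V := Finset.sum_pos (fun k _ => hv0 k) Finset.univ_nonempty
  set r₁ : Fin N → ℝ := fun k => w k / W with hr₁
  set r₂ : Fin N → ℝ := fun k => v k / V with hr₂
  have hr₁p : IsProb r₁ := ⟨fun k => (div_pos (hw k) hW0).le, by
    simp only [hr₁]; rw [← Finset.sum_div, ← hW, div_self hW0.ne']⟩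
  have hr₂p : IsProb r₂ := ⟨fun k => (div_pos (hv0 k) hV0).le, by
    simp only [hr₂]; rw [← Finset.sum_div, ← hV, div_self hV0.ne']⟩
  have hr₂0 : ∀ k, 0 < r₂ k := fun k => div_pos (hv0 k) hV0
  have hG : ∀ x : I × Fin N, 0 < kron g r₂ x := fun x => mul_pos (hg _) (hr₂0 _)
  have hsum : ∀ {p : I → ℝ} {r : Fin N → ℝ}, IsProb p → IsProb r → ∑ x, kron p r x = 1 := by
    intro p r hp hr
    simp only [kron]
    rw [Fintype.sum_prod_type]
    simp only [← Finset.mul_sum, hr.2, mul_one, hp.2]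
  have hkron : ∀ (p : I → ℝ) (s : ℝ), ∑ x, max (kron p r₁ x - Real.exp s * kron g r₂ x) 0
      = W⁻¹ * ∑ k, w k * hingeSum p g (s + Real.log (W / V) - z k) := by
    intro p s
    rw [Fintype.sum_prod_type, Finset.sum_comm, Finset.mul_sum]
    refine Finset.sum_congr rfl fun k _ => ?_
    rw [← mul_assoc, hingeSum, Finset.mul_sum]
    refine Finset.sum_congr rfl fun x _ => ?_
    rw [mul_max_of_nonneg _ _ (mul_pos (inv_pos.2 hW0) (hw k)).le, mul_zero]
    congr 1
    simp only [kron, hr₁, hr₂, hv]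
    rw [sub_eq_add_neg _ (z k), Real.exp_add, Real.exp_add, Real.exp_log (div_pos hW0 hV0)]
    field_simp
  have hhinge : ∀ τ : ℝ, ∑ y, max (kron q r₁ y - τ * kron g r₂ y) 0
      ≤ ∑ x, max (kron p r₁ x - τ * kron g r₂ x) 0 := by
    intro τ
    rcases le_or_gt τ 0 with hτ | hτ
    · have e : ∀ {p : I → ℝ}, IsProb p →
          ∑ x, max (kron p r₁ x - τ * kron g r₂ x) 0 = 1 - τ := by
        intro p hp
        have : ∀ x, max (kron p r₁ x - τ * kron g r₂ x) 0 = kron p r₁ x - τ * kron g r₂ x := by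
          intro x
          refine max_eq_left ?_
          have h1 : 0 ≤ kron p r₁ x := kron_nonneg hp.1 hr₁p.1 x
          nlinarith [hG x]
        simp only [this]
        rw [Finset.sum_sub_distrib, ← Finset.mul_sum, hsum hp hr₁p, hsum hgp hr₂p, mul_one]
      rw [e hp, e hq]
    · rw [← Real.exp_log hτ, hkron, hkron]
      refine mul_le_mul_of_nonneg_left ?_ (inv_pos.2 hW0).le
      have := hker (Real.log τ + Real.log (W / V))
      simp only [mul_sub, Finset.sum_sub_distrib] at this
      linarith
  obtain ⟨T, hT, hT1, hT2⟩ := exists_stoch_of_hinge hG hG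
    ((hsum hq hr₁p).trans (hsum hp hr₁p).symm) rfl hhinge
  exact ⟨Fin N, inferInstance, r₁, r₂, hr₁p, hr₂p, fun k _ => (hr₂0 k).ne', T, hT, hT1, hT2⟩

theorem MomentDominates.exists_approx {p q g : I → ℝ}
    (H : MomentDominates p q g) (hp : IsProb p) (hq : IsProb q) (hgp : IsProb g)
    (hg : ∀ x, 0 < g x) (hpg : p ≠ g) {ε : ℝ} (hε : 0 < ε) :
    ∃ q' : I → ℝ, IsProb q' ∧ dist1 q q' ≤ ε ∧ CatalyticallyTransforms p q' g := by
  obtain ⟨δ, h0, h1, h2⟩ : ∃ δ : ℝ, 0 < δ ∧ δ < 1 ∧ 2 * δ ≤ ε :=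
    ⟨min (ε / 2) (1 / 2), by positivity, (min_le_right _ _).trans_lt (by norm_num), by
      linarith [min_le_left (ε / 2) (1 / 2)]⟩
  obtain ⟨N, w, z, hN, hw, hker⟩ := H.exists_hinge_kernel hp hq hgp hg hpg h0 h1
  have hmix := hq.mixWith h0.le h1.le hgp
  exact ⟨_, hmix, (dist1_mixWith_le h0.le hq hgp).trans h2,
    catalyticallyTransforms_of_hinge_kernel hp hmix hgp hg hN hw hker⟩

end Sufficiency

/-- asymptotic catalytic thermal majorization, classical case.  Let
`g` be the Gibbs probability vector of strictly positive energies `E` at inverse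
temperature `β > 0`, and let `p ≠ g` and `q` be probability vectors on `n` points.
Then `p` asymptotically catalytically thermally majorizes `q` (condition (1)) if and
only if `D_α(p‖g) ≥ D_α(q‖g)` and `D_α(g‖p) ≥ D_α(g‖q)` for every `α ≥ 1/2`
(condition (2)). -/
theorem stmt19 (n : ℕ) (hn : 0 < n) (β : ℝ) (hβ : 0 < β)
    (E : Fin n → ℝ) (hE : ∀ i, 0 < E i)
    (g : Fin n → ℝ)
    (hg : ∀ i, g i = Real.exp (-(β * E i)) / ∑ j, Real.exp (-(β * E j)))
    (p q : Fin n → ℝ) (hp : IsProb p) (hq : IsProb q) (hpg : p ≠ g) :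
    ((∀ ε : ℝ, 0 < ε →
        ∃ qe : Fin n → ℝ, IsProb qe ∧ dist1 q qe ≤ ε ∧
          ∃ (R : Type) (_ : Fintype R) (r₁ r₂ : R → ℝ),
            IsProb r₁ ∧ IsProb r₂ ∧ (∀ z, r₁ z ≠ 0 → r₂ z ≠ 0) ∧
            ∃ T : Fin n × R → Fin n × R → ℝ, IsStoch T ∧
              (∀ y, ∑ x, T y x * kron p r₁ x = kron qe r₁ y) ∧
              (∀ y, ∑ x, T y x * kron g r₂ x = kron g r₂ y)) ↔
      (∀ α : ℝ, 1 / 2 ≤ α →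
        renyi α q g ≤ renyi α p g ∧ renyi α g q ≤ renyi α g p)) := by
  have hne : Nonempty (Fin n) := ⟨⟨0, hn⟩⟩
  have hZ : 0 < ∑ j, Real.exp (-(β * E j)) :=
    Finset.sum_pos (fun j _ => Real.exp_pos _) Finset.univ_nonempty
  have hg0 : ∀ x, 0 < g x := fun x => by
    rw [hg]
    exact div_pos (Real.exp_pos _) hZ
  have hgp : IsProb g := ⟨fun x => (hg0 x).le, by
    simp only [hg]
    rw [← Finset.sum_div, div_self hZ.ne']⟩
  rw [renyi_forall_le_iff_momentDominates hp hq hg0]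
  exact ⟨fun H => momentDominates_of_approx hp hq hgp hg0 H,
    fun H ε hε => H.exists_approx hp hq hgp hg0 hpg hε⟩
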